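/- arXiv:1904.07626 — 4 statements merged into one kernel-verified Lean document; each statement's English description precedes it below -/
import Mathlib

section
/- Let q ≥ 4 be a prime power and let K be a finite field extension of F, with Z = |K|. Then the number of codewords g of the extended Veronese code C_q(K) with wt(g) = q^2 − q equals binom(q^2+q+1, 2)·(Z − 1). -/
noncomputable section

open MvPolynomial

/-- The projective plane over `F`: the projectivization of `F^3`. -/
abbrev Plane (F : Type*) [Field F] := Projectivization F (Fin 3 → F)

/-- The extended Veronese code over a field extension `K` of `F`: evaluations of
homogeneous degree-2 polynomials with coefficients in `K` at the chosen representatives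
of the points of the projective plane over `F`, regarded as vectors of `K^3`. -/
def VeroneseCodeExt {F : Type*} [Field F] (K : Type*) [Field K] [Algebra F K]
    (rep : Plane F → (Fin 3 → F)) : Submodule K (Plane F → K) :=
  (MvPolynomial.homogeneousSubmodule (Fin 3) K 2).map
    (LinearMap.pi fun p =>
      (MvPolynomial.aeval (fun i => algebraMap F K (rep p i))).toLinearMap)

/-- The (Hamming) weight of a word: the size of its support. -/
def wt {α K : Type*} [Zero K] (g : α → K) : ℕ := Nat.card {p | g p ≠ 0}

open Configuration Matrix

section helpers

variable {F : Type*} [Field F]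

lemma vx_mem_iff (rep : Plane F → (Fin 3 → F))
    (hrep : ∀ p : Plane F, ∃ h : rep p ≠ 0, Projectivization.mk F (rep p) h = p)
    (p a : Plane F) : p ∈ a ↔ rep p ⬝ᵥ rep a = 0 := by
  obtain ⟨hp, hp'⟩ := hrep p
  obtain ⟨ha, ha'⟩ := hrep a
  rw [← Projectivization.orthogonal_mk hp ha, hp', ha']
  exact Configuration.ofField.mem_iff p a

lemma vx_ne (rep : Plane F → (Fin 3 → F))
    (hrep : ∀ p : Plane F, ∃ h : rep p ≠ 0, Projectivization.mk F (rep p) h = p)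
    {p r : Plane F} (h : p ≠ r) (c : F) : rep p ≠ c • rep r := by
  intro hc
  obtain ⟨hp, hp'⟩ := hrep p
  obtain ⟨ha, ha'⟩ := hrep r
  apply h
  rw [← hp', ← ha', Projectivization.mk_eq_mk_iff']
  exact ⟨c, hc.symm⟩

lemma vx_span (rep : Plane F → (Fin 3 → F))
    (hrep : ∀ p : Plane F, ∃ h : rep p ≠ 0, Projectivization.mk F (rep p) h = p)
    {p r w a : Plane F} (h : p ≠ r) (hp : p ∈ a) (hr : r ∈ a) (hw : w ∈ a) :
    ∃ s t : F, rep w = s • rep p + t • rep r := by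
  rw [vx_mem_iff rep hrep] at hp hr hw
  have hdet : (Matrix.of ![rep p, rep r, rep w]).det = 0 := by
    rw [← Matrix.exists_mulVec_eq_zero_iff]
    refine ⟨rep a, (hrep a).1, ?_⟩
    ext i
    fin_cases i
    · exact hp
    · exact hr
    · exact hw
  rw [← Matrix.exists_vecMul_eq_zero_iff] at hdet
  obtain ⟨c, hc0, hc⟩ := hdet
  have hc' : c 0 • rep p + c 1 • rep r + c 2 • rep w = 0 := by
    ext i
    have := congrFun hc i
    simpa [Matrix.vecMul, dotProduct, Fin.sum_univ_three] using this
  by_cases h2 : c 2 = 0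
  · exfalso
    rw [h2, zero_smul, add_zero] at hc'
    by_cases h0 : c 0 = 0
    · rw [h0, zero_smul, zero_add] at hc'
      have h1 : c 1 = 0 := (smul_eq_zero.1 hc').resolve_right (hrep r).1
      apply hc0
      ext i
      fin_cases i <;> simp [h0, h1, h2]
    · apply vx_ne rep hrep h (-(c 0)⁻¹ * c 1)
      have : rep p = (c 0)⁻¹ • (c 0 • rep p) := by rw [smul_smul, inv_mul_cancel₀ h0, one_smul]
      rw [this, eq_neg_of_add_eq_zero_left hc', smul_neg, smul_smul, neg_mul, neg_smul]
  · refine ⟨-(c 2)⁻¹ * c 0, -(c 2)⁻¹ * c 1, ?_⟩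
    have : rep w = (c 2)⁻¹ • (c 2 • rep w) := by rw [smul_smul, inv_mul_cancel₀ h2, one_smul]
    rw [this, eq_neg_of_add_eq_zero_right hc']
    simp only [smul_neg, smul_add, smul_smul, neg_mul, neg_smul, neg_add]

lemma vx_vec (rep : Plane F → (Fin 3 → F))
    (hrep : ∀ p : Plane F, ∃ h : rep p ≠ 0, Projectivization.mk F (rep p) h = p)
    (x : Fin 3 → F) : x = 0 ∨ ∃ (c : F) (p : Plane F), c ≠ 0 ∧ x = c • rep p := by
  by_cases hx : x = 0
  · exact Or.inl hx
  · right
    obtain ⟨hp, hp'⟩ := hrep (Projectivization.mk F x hx)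
    rw [eq_comm, Projectivization.mk_eq_mk_iff] at hp'
    obtain ⟨c, hc⟩ := hp'
    exact ⟨c, _, c.ne_zero, hc.symm⟩

lemma vx_dual (v : Fin 3 → F) (hv : v ≠ 0) : ∃ e : Fin 3 → F, e ⬝ᵥ v = 1 := by
  obtain ⟨i, hi⟩ := Function.ne_iff.1 hv
  exact ⟨Pi.single i (v i)⁻¹, by simpa using inv_mul_cancel₀ hi⟩

variable {K : Type*} [Field K] [Algebra F K]

/-- a quadratic polynomial gives a quadratic map -/
lemma vx_quad (f : MvPolynomial (Fin 3) K) (hf : f.IsHomogeneous 2) :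
    ∃ Q : QuadraticMap F (Fin 3 → F) K, ∀ x : Fin 3 → F,
      Q x = MvPolynomial.aeval (fun i => algebraMap F K (x i)) f := by
  rw [f.as_sum]
  have key : ∀ d ∈ f.support, ∃ Q : QuadraticMap F (Fin 3 → F) K, ∀ x : Fin 3 → F,
      Q x = MvPolynomial.aeval (fun i => algebraMap F K (x i))
        (MvPolynomial.monomial d (f.coeff d)) := by
    intro d hd
    have hdeg : d.degree = 2 := by
      have := hf (MvPolynomial.mem_support_iff.1 hd)
      rwa [Finsupp.degree_eq_weight_one]
    have hsplit : ∀ (n : ℕ) (e : Fin 3 →₀ ℕ), e.degree = n + 1 →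
        ∃ (i : Fin 3) (e' : Fin 3 →₀ ℕ), e = Finsupp.single i 1 + e' ∧ e'.degree = n := by
      intro n e he
      obtain ⟨i, hi⟩ : ∃ i, e i ≠ 0 := by
        by_contra hcon
        push Not at hcon
        have : e = 0 := Finsupp.ext hcon
        simp [this] at he
      have hee : e = Finsupp.single i 1 + (e - Finsupp.single i 1) :=
        (add_tsub_cancel_of_le (Finsupp.single_le_iff.2 (Nat.one_le_iff_ne_zero.2 hi))).symm
      refine ⟨i, e - Finsupp.single i 1, hee, ?_⟩
      rw [hee, map_add, Finsupp.degree_single] at he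
      omega
    obtain ⟨i, d', rfl, hd'⟩ := hsplit 1 d hdeg
    obtain ⟨j, d'', rfl, hd''⟩ := hsplit 0 d' hd'
    obtain rfl := (Finsupp.degree_eq_zero_iff _).1 hd''
    simp only [add_zero] at *
    refine ⟨QuadraticMap.linMulLin
      (((LinearMap.mulLeft F (f.coeff (Finsupp.single i 1 + Finsupp.single j 1))).comp
        (Algebra.linearMap F K)).comp (LinearMap.proj i))
      ((Algebra.linearMap F K).comp (LinearMap.proj j)), fun x => ?_⟩
    rw [MvPolynomial.aeval_monomial, Finsupp.prod_add_index' (by simp) (by intros; exact pow_add ..)]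
    simp [mul_assoc]
  choose! Q hQ using key
  refine ⟨∑ d ∈ f.support, Q d, fun x => ?_⟩
  rw [_root_.sum_apply, map_sum]
  exact Finset.sum_congr rfl fun d hd => hQ d hd x

lemma vx_expand (Q : QuadraticMap F (Fin 3 → F) K) (u v : Fin 3 → F) (s t : F) :
    Q (s • u + t • v) = (s * s) • Q u + (t * t) • Q v + (s * t) • QuadraticMap.polar Q u v := by
  rw [QuadraticMap.map_add Q, QuadraticMap.map_smul, QuadraticMap.map_smul,
    QuadraticMap.polar_smul_left, QuadraticMap.polar_smul_right, smul_smul]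

/-- three collinear zeros force a whole line of zeros -/
lemma vx_three (rep : Plane F → (Fin 3 → F))
    (hrep : ∀ p : Plane F, ∃ h : rep p ≠ 0, Projectivization.mk F (rep p) h = p)
    (Q : QuadraticMap F (Fin 3 → F) K) {a u v w : Plane F} (huv : u ≠ v) (hwu : w ≠ u)
    (hwv : w ≠ v) (hu : u ∈ a) (hv : v ∈ a) (hw : w ∈ a) (qu : Q (rep u) = 0)
    (qv : Q (rep v) = 0) (qw : Q (rep w) = 0) (z : Plane F) (hz : z ∈ a) : Q (rep z) = 0 := by
  have hB : QuadraticMap.polar Q (rep u) (rep v) = 0 := by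
    obtain ⟨s, t, hst⟩ := vx_span rep hrep huv hu hv hw
    have hs : s ≠ 0 := by
      rintro rfl
      exact vx_ne rep hrep hwv t (by simpa using hst)
    have ht : t ≠ 0 := by
      rintro rfl
      exact vx_ne rep hrep hwu s (by simpa using hst)
    rw [hst, vx_expand, qu, qv] at qw
    simpa [hs, ht] using qw
  obtain ⟨s, t, hst⟩ := vx_span rep hrep huv hu hv hz
  rw [hst, vx_expand, qu, qv, hB]
  simp

/-- if `Q` vanishes on the line `a` then `Q` is divisible by the line -/
lemma vx_factor (rep : Plane F → (Fin 3 → F))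
    (hrep : ∀ p : Plane F, ∃ h : rep p ≠ 0, Projectivization.mk F (rep p) h = p)
    (Q : QuadraticMap F (Fin 3 → F) K) {a : Plane F}
    (h : ∀ z : Plane F, z ∈ a → Q (rep z) = 0) :
    ∃ m : (Fin 3 → F) →ₗ[F] K, ∀ x, Q x = (x ⬝ᵥ rep a) • m x := by
  obtain ⟨e, he⟩ := vx_dual (rep a) (hrep a).1
  have hker : ∀ y : Fin 3 → F, y ⬝ᵥ rep a = 0 → Q y = 0 := by
    intro y hy
    rcases vx_vec rep hrep y with rfl | ⟨c, p, hc, rfl⟩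
    · exact QuadraticMap.map_zero Q
    · rw [smul_dotProduct, smul_eq_mul, mul_eq_zero] at hy
      rw [QuadraticMap.map_smul, h p ((vx_mem_iff rep hrep p a).2 (hy.resolve_left hc)), smul_zero]
  let l : (Fin 3 → F) →ₗ[F] F := (dotProductBilin F F).flip (rep a)
  have hl : ∀ x, l x = x ⬝ᵥ rep a := fun x => rfl
  refine ⟨l.smulRight (Q e - QuadraticMap.polar Q e e) + QuadraticMap.polarBilin Q e, fun x => ?_⟩
  set c := x ⬝ᵥ rep a with hc
  have hx : x = c • e + (1 : F) • (x - c • e) := by simp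
  have hy : Q (x - c • e) = 0 := by
    apply hker
    rw [sub_dotProduct, smul_dotProduct, he, ← hc]
    simp
  conv_lhs => rw [hx]
  rw [vx_expand, hy]
  simp only [LinearMap.add_apply, LinearMap.smulRight_apply, QuadraticMap.polarBilin_apply_apply,
    hl, ← hc, QuadraticMap.polar_sub_right, QuadraticMap.polar_smul_right]
  simp only [Algebra.smul_def, map_mul, map_one]
  ring

/-- a linear map vanishing on two points is a multiple of the line -/
lemma vx_linear (rep : Plane F → (Fin 3 → F))
    (hrep : ∀ p : Plane F, ∃ h : rep p ≠ 0, Projectivization.mk F (rep p) h = p)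
    (m : (Fin 3 → F) →ₗ[F] K) {b u v : Plane F} (huv : u ≠ v) (hu : u ∈ b) (hv : v ∈ b)
    (mu : m (rep u) = 0) (mv : m (rep v) = 0) :
    ∃ c : K, ∀ x, m x = (x ⬝ᵥ rep b) • c := by
  obtain ⟨e, he⟩ := vx_dual (rep b) (hrep b).1
  refine ⟨m e, fun x => ?_⟩
  have hker : ∀ y : Fin 3 → F, y ⬝ᵥ rep b = 0 → m y = 0 := by
    intro y hy
    rcases vx_vec rep hrep y with rfl | ⟨c, p, hc, rfl⟩
    · exact map_zero m
    · rw [smul_dotProduct, smul_eq_mul, mul_eq_zero] at hy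
      obtain ⟨s, t, hst⟩ := vx_span rep hrep huv hu hv
        ((vx_mem_iff rep hrep p b).2 (hy.resolve_left hc))
      simp [hst, mu, mv]
  have := hker (x - (x ⬝ᵥ rep b) • e) (by rw [sub_dotProduct, smul_dotProduct, he]; simp)
  rw [map_sub, map_smul] at this
  exact sub_eq_zero.1 this

variable [Fintype F]

lemma vx_card : Nat.card (Plane F) = Fintype.card F ^ 2 + Fintype.card F + 1 := by
  rw [Projectivization.card_of_finrank F (Fin 3 → F) (n := 3) (by simp), Nat.card_eq_fintype_card]
  simp [Finset.sum_range_succ]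
  ring

open Classical in
lemma vx_order : ProjectivePlane.order (Plane F) (Plane F) = Fintype.card F := by
  have : Fintype (Plane F) := Fintype.ofFinite _
  have h := ProjectivePlane.card_points (Plane F) (Plane F)
  rw [← Nat.card_eq_fintype_card, vx_card] at h
  nlinarith

lemma vx_pts (a : Plane F) : {p : Plane F | p ∈ a}.ncard = Fintype.card F + 1 := by
  classical
  rw [← vx_order, ← ProjectivePlane.pointCount_eq (Plane F) a]
  rfl

lemma vx_lines (p : Plane F) : {a : Plane F | p ∈ a}.ncard = Fintype.card F + 1 := by
  classical
  rw [← vx_order, ← ProjectivePlane.lineCount_eq (Plane F) p]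
  rfl

lemma vx_union {a b : Plane F} (h : a ≠ b) :
    ({p : Plane F | p ∈ a} ∪ {p : Plane F | p ∈ b}).ncard = 2 * Fintype.card F + 1 := by
  classical
  have h1 := Set.ncard_union_add_ncard_inter {p : Plane F | p ∈ a} {p : Plane F | p ∈ b}
  have h2 : ({p : Plane F | p ∈ a} ∩ {p : Plane F | p ∈ b}).ncard = 1 := by
    obtain ⟨z, hz, hz'⟩ := HasPoints.existsUnique_point (Plane F) (Plane F) a b h
    rw [Set.ncard_eq_one]
    refine ⟨z, Set.ext fun y => ⟨fun hy => hz' y hy, ?_⟩⟩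
    rintro rfl
    exact hz
  rw [vx_pts, vx_pts, h2] at h1
  omega

/-- the lines contained in a union of two lines -/
lemma vx_subset {a b c : Plane F} (hq : 4 ≤ Fintype.card F)
    (h : ∀ p, p ∈ c → p ∈ a ∨ p ∈ b) : c = a ∨ c = b := by
  classical
  by_contra hcon
  push Not at hcon
  have h1 : {p : Plane F | p ∈ c} ⊆
      ({p : Plane F | p ∈ c} ∩ {p | p ∈ a}) ∪ ({p : Plane F | p ∈ c} ∩ {p | p ∈ b}) := by
    intro p hp
    rcases h p hp with h | h
    · exact Or.inl ⟨hp, h⟩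
    · exact Or.inr ⟨hp, h⟩
  have h2 : ∀ d : Plane F, c ≠ d → ({p : Plane F | p ∈ c} ∩ {p : Plane F | p ∈ d}).ncard ≤ 1 := by
    intro d hd
    rw [Set.ncard_le_one]
    intro x hx y hy
    exact (Nondegenerate.eq_or_eq (l₁ := c) (l₂ := d) hx.1 hy.1 hx.2 hy.2).resolve_right hd
  have h3 := (Set.ncard_le_ncard h1).trans (Set.ncard_union_le _ _)
  rw [vx_pts] at h3
  have := h2 a hcon.1
  have := h2 b hcon.2
  omega

lemma vx_classify (rep : Plane F → (Fin 3 → F))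
    (hrep : ∀ p : Plane F, ∃ h : rep p ≠ 0, Projectivization.mk F (rep p) h = p)
    (hq : 4 ≤ Fintype.card F)
    (Q : QuadraticMap F (Fin 3 → F) K)
    (hZ : {p : Plane F | Q (rep p) = 0}.ncard = 2 * Fintype.card F + 1) :
    ∃ (a b : Plane F) (c : K), a ≠ b ∧ c ≠ 0 ∧ ∀ x, Q x =
      c * (algebraMap F K (x ⬝ᵥ rep a) * algebraMap F K (x ⬝ᵥ rep b)) := by
  classical
  -- a line inside the zero set
  obtain ⟨a, ha⟩ : ∃ a : Plane F, ∀ z : Plane F, z ∈ a → Q (rep z) = 0 := by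
    obtain ⟨p, hp⟩ : {p : Plane F | Q (rep p) = 0}.Nonempty :=
      Set.nonempty_of_ncard_ne_zero (by omega)
    have hcard : ({p : Plane F | Q (rep p) = 0} \ {p}).ncard = 2 * Fintype.card F := by
      rw [Set.ncard_sdiff_singleton_of_mem hp]
      omega
    let f : Plane F → Plane F := fun z => if h : p ≠ z then HasLines.mkLine h else p
    have hf : ∀ z, p ≠ z → p ∈ f z ∧ z ∈ f z := by
      intro z hz
      simp only [f, dif_pos hz]
      exact HasLines.mkLine_ax hz
    obtain ⟨y, hy, z, hz, hyz, hfe⟩ := Set.exists_ne_map_eq_of_ncard_lt_of_maps_to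
      (s := {p : Plane F | Q (rep p) = 0} \ {p}) (t := {a : Plane F | p ∈ a})
      (by rw [hcard, vx_lines]; omega) (f := f)
      (fun z hz => (hf z (fun h => hz.2 h.symm)).1)
    have hyp : y ≠ p := hy.2
    have hzp : z ≠ p := hz.2
    refine ⟨f y, vx_three rep hrep Q hyz.symm hzp.symm hyp.symm ?_ (hf y hyp.symm).2
      (hf y hyp.symm).1 hz.1 hy.1 hp⟩
    rw [hfe]
    exact (hf z hzp.symm).2
  obtain ⟨m, hm⟩ := vx_factor rep hrep Q ha
  have hdiff : ({p : Plane F | Q (rep p) = 0} \ {p | p ∈ a}).ncard = Fintype.card F := by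
    rw [Set.ncard_sdiff (show {p | p ∈ a} ⊆ {p : Plane F | Q (rep p) = 0} from fun p hp => ha p hp), hZ, vx_pts]
    omega
  obtain ⟨u, hu, v, hv, huv⟩ := (Set.one_lt_ncard (Set.toFinite _)).1
    (show 1 < ({p : Plane F | Q (rep p) = 0} \ {p | p ∈ a}).ncard by omega)
  have hmz : ∀ w ∈ ({p : Plane F | Q (rep p) = 0} \ {p | p ∈ a}), m (rep w) = 0 := by
    rintro w ⟨hw, hwa⟩
    have hw' : Q (rep w) = 0 := hw
    rw [hm] at hw'
    exact (smul_eq_zero.1 hw').resolve_left fun h => hwa ((vx_mem_iff rep hrep w a).2 h)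
  have hax := HasLines.mkLine_ax (L := Plane F) huv
  obtain ⟨c, hc⟩ := vx_linear rep hrep m huv hax.1 hax.2 (hmz u hu) (hmz v hv)
  refine ⟨a, HasLines.mkLine huv, c, ?_, ?_, ?_⟩
  · intro h
    apply hu.2
    rw [h]
    exact hax.1
  · rintro rfl
    have : {p : Plane F | Q (rep p) = 0} = Set.univ := by
      ext p
      simp [hm, hc]
    rw [this, Set.ncard_univ, vx_card] at hZ
    nlinarith
  · intro x
    rw [hm, hc, Algebra.smul_def, Algebra.smul_def]
    ring

/-- the product of two lines -/
lemma vx_code (rep : Plane F → (Fin 3 → F)) (a b : Plane F) (c : K) :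
    (fun p => c * (algebraMap F K (rep p ⬝ᵥ rep a) * algebraMap F K (rep p ⬝ᵥ rep b))) ∈
      VeroneseCodeExt K rep := by
  let l : Plane F → MvPolynomial (Fin 3) K := fun a =>
    ∑ i, MvPolynomial.C (algebraMap F K (rep a i)) * MvPolynomial.X i
  have hl : ∀ a, (l a).IsHomogeneous 1 := by
    intro a
    refine MvPolynomial.IsHomogeneous.sum _ _ _ fun i _ => ?_
    simpa using (MvPolynomial.isHomogeneous_C _ _).mul (MvPolynomial.isHomogeneous_X K i)
  refine ⟨MvPolynomial.C c * (l a * l b), ?_, ?_⟩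
  · simpa using (MvPolynomial.isHomogeneous_C _ c).mul ((hl a).mul (hl b))
  · ext p
    simp [l, dotProduct, mul_comm]

end helpers

theorem veronese_ext_count_weight_qsq_sub_q
    {F : Type*} [Field F] [Fintype F] (q : ℕ) (hq : Fintype.card F = q) (hq4 : 4 ≤ q)
    (rep : Plane F → (Fin 3 → F))
    (hrep : ∀ p : Plane F, ∃ h : rep p ≠ 0, Projectivization.mk F (rep p) h = p)
    (K : Type*) [Field K] [Fintype K] [Algebra F K] :
    Nat.card {g : Plane F → K | g ∈ VeroneseCodeExt K rep ∧ wt g = q ^ 2 - q} =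
      (q ^ 2 + q + 1).choose 2 * (Fintype.card K - 1) := by
  classical
  subst hq
  have : Fintype (Plane F) := Fintype.ofFinite _
  have hcardP : Fintype.card (Plane F) = Fintype.card F ^ 2 + Fintype.card F + 1 := by
    rw [← Nat.card_eq_fintype_card, vx_card]
  have hwt : ∀ g : Plane F → K, wt g = Fintype.card F ^ 2 - Fintype.card F ↔
      {p : Plane F | g p = 0}.ncard = 2 * Fintype.card F + 1 := by
    intro g
    have h1 : wt g + {p : Plane F | g p = 0}.ncard =
        Fintype.card F ^ 2 + Fintype.card F + 1 := by
      rw [← vx_card, ← Set.ncard_add_ncard_compl {p : Plane F | g p ≠ 0}]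
      congr 2
      ext p
      simp
    have h2 : Fintype.card F ≤ Fintype.card F ^ 2 := by nlinarith
    omega
  let S : Finset (Finset (Plane F)) := Finset.powersetCard 2 Finset.univ
  let T : Finset K := Finset.univ.erase 0
  let Φ : Finset (Plane F) × K → (Plane F → K) := fun sc p =>
    sc.2 * ∏ a ∈ sc.1, algebraMap F K (rep p ⬝ᵥ rep a)
  have hzero : ∀ (s : Finset (Plane F)) (c : K), c ≠ 0 → ∀ p, Φ (s, c) p = 0 ↔ ∃ a ∈ s, p ∈ a := by
    intro s c hc p
    simp only [Φ, mul_eq_zero, hc, false_or, Finset.prod_eq_zero_iff,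
      FaithfulSMul.algebraMap_eq_zero_iff, vx_mem_iff rep hrep]
  have himg : {g : Plane F → K | g ∈ VeroneseCodeExt K rep ∧
      wt g = Fintype.card F ^ 2 - Fintype.card F} = ((S ×ˢ T).image Φ : Finset _) := by
    ext g
    simp only [Set.mem_ofPred_eq, Finset.coe_image, Set.mem_image, Finset.mem_coe,
      Finset.mem_product, Prod.exists, hwt]
    constructor
    · rintro ⟨⟨f, hf, rfl⟩, hg⟩
      obtain ⟨Q, hQ⟩ := vx_quad (F := F) f hf
      obtain ⟨a, b, c, hab, hc, hQ'⟩ := vx_classify rep hrep hq4 Q (by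
        rw [← hg]
        simp only [hQ]
        rfl)
      refine ⟨{a, b}, c, ⟨?_, ?_⟩, ?_⟩
      · simp [S, Finset.mem_powersetCard, Finset.card_pair hab]
      · simp [T, hc]
      · ext p
        simp only [Φ, Finset.prod_pair hab]
        rw [← hQ', hQ]
        rfl
    · rintro ⟨s, c, ⟨hs, hc⟩, rfl⟩
      have hc0 : c ≠ 0 := by simpa [T] using hc
      obtain ⟨a, b, hab, rfl⟩ := Finset.card_eq_two.1 (Finset.mem_powersetCard.1 hs).2
      constructor
      · have := vx_code (K := K) rep a b c
        simpa only [Φ, Finset.prod_pair hab] using this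
      · rw [← vx_union hab]
        congr 1
        ext p
        rw [Set.mem_ofPred_eq, hzero _ _ hc0]
        simp
  have hinj : Set.InjOn Φ (S ×ˢ T : Finset _) := by
    rintro ⟨s, c⟩ hs ⟨t, d⟩ ht hst
    simp only [Finset.mem_coe, Finset.mem_product] at hs ht
    have hc0 : c ≠ 0 := by simpa [T] using hs.2
    have hd0 : d ≠ 0 := by simpa [T] using ht.2
    have hsub : ∀ s ∈ S, ∀ t ∈ S, (∀ p, (∃ a ∈ s, p ∈ a) → ∃ a ∈ t, p ∈ a) → s ⊆ t := by
      intro s hs t ht h x hx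
      obtain ⟨a, b, hab, rfl⟩ := Finset.card_eq_two.1 (Finset.mem_powersetCard.1 ht).2
      have := vx_subset (a := a) (b := b) (c := x) hq4 (fun p hp => by
        simpa using h p ⟨x, hx, hp⟩)
      simpa using this
    have hiff : ∀ p, (∃ a ∈ s, p ∈ a) ↔ ∃ a ∈ t, p ∈ a := by
      intro p
      rw [← hzero s c hc0, hst, hzero t d hd0]
    have hEq : s = t := (hsub s hs.1 t ht.1 fun p => (hiff p).1).antisymm
      (hsub t ht.1 s hs.1 fun p => (hiff p).2)
    subst hEq
    obtain ⟨p, hp⟩ : ∃ p : Plane F, ¬ ∃ a ∈ s, p ∈ a := by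
      by_contra hcon
      push Not at hcon
      obtain ⟨a, b, hab, rfl⟩ := Finset.card_eq_two.1 (Finset.mem_powersetCard.1 hs.1).2
      have h1 := vx_union hab
      have h2 : ({p : Plane F | p ∈ a} ∪ {p : Plane F | p ∈ b}) = Set.univ := by
        ext p
        simpa using hcon p
      rw [h2, Set.ncard_univ, vx_card] at h1
      nlinarith
    have h3 : Φ (s, c) p = Φ (s, d) p := by rw [hst]
    rw [← hzero s 1 one_ne_zero] at hp
    simp only [Φ, one_mul] at hp h3
    rw [mul_right_cancel₀ hp h3]
  rw [himg, Nat.card_eq_card_toFinset, Finset.toFinset_coe, Finset.card_image_of_injOn hinj,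
    Finset.card_product, Finset.card_powersetCard, Finset.card_univ, hcardP,
    Finset.card_erase_of_mem (Finset.mem_univ _), Finset.card_univ]
end
end

section
/- Let q ≥ 4 be a prime power and let K be a finite field extension of F, with Z = |K|. Then the number of codewords g of the extended Veronese code C_q(K) with wt(g) = q^2 − 1 equals (q^2+q+1)·q^2·(Z − q)·(Z − 1). -/
noncomputable section

open MvPolynomial

namespace VeroneseAux

open Module

variable {F : Type*} [Field F] {K : Type*} [Field K] [Algebra F K]

lemma exists_basis_triple {v w u : Fin 3 → F} (hv : v ≠ 0) (hw : ∀ a : F, a • v ≠ w)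
    (hu : ∀ a c : F, a • v + c • w ≠ u) :
    ∃ b : Basis (Fin 3) F (Fin 3 → F), b 0 = v ∧ b 1 = w ∧ b 2 = u := by
  have li2 : LinearIndependent F ![v, w] := (LinearIndependent.pair_iff' hv).2 hw
  have li : LinearIndependent F ![u, v, w] := by
    refine linearIndependent_finCons.2 ⟨li2, ?_⟩
    intro h
    rw [Matrix.range_cons, Matrix.range_cons, Matrix.range_empty, Set.union_empty,
      Set.singleton_union, Submodule.mem_span_pair] at h
    obtain ⟨a, c, h⟩ := h
    exact hu a c h
  let b0 := basisOfLinearIndependentOfCardEqFinrank li (by simp)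
  have hb0 : ⇑b0 = ![u, v, w] := coe_basisOfLinearIndependentOfCardEqFinrank _ _
  refine ⟨b0.reindex (finRotate 3).symm, ?_, ?_, ?_⟩ <;>
    simp [hb0, Basis.reindex_apply]

lemma exists_basis_pair {v w : Fin 3 → F} (hv : v ≠ 0) (hw : ∀ a : F, a • v ≠ w) :
    ∃ b : Basis (Fin 3) F (Fin 3 → F), b 0 = v ∧ b 1 = w := by
  by_contra hcon
  have : ∀ u, ∃ a c : F, a • v + c • w = u := by
    intro u
    by_contra! h
    obtain ⟨b, h0, h1, -⟩ := exists_basis_triple hv hw h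
    exact hcon ⟨b, h0, h1⟩
  have hs : Submodule.span F (Set.range ![v, w]) = ⊤ := by
    rw [eq_top_iff]
    rintro u -
    rw [Matrix.range_cons, Matrix.range_cons, Matrix.range_empty, Set.union_empty,
      Set.singleton_union, Submodule.mem_span_pair]
    exact this u
  have h := finrank_range_le_card (R := F) ![v, w]
  rw [Set.finrank, hs, finrank_top] at h
  simp at h

lemma exists_basis_one {v : Fin 3 → F} (hv : v ≠ 0) :
    ∃ b : Basis (Fin 3) F (Fin 3 → F), b 0 = v := by
  obtain ⟨y, hy⟩ := exists_linearIndependent_pair_of_one_lt_finrank (R := F)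
    (M := Fin 3 → F) (by simp) hv
  obtain ⟨b, h, -⟩ := exists_basis_pair hv ((LinearIndependent.pair_iff' hv).1 hy)
  exact ⟨b, h⟩

lemma basis_expand (b : Basis (Fin 3) F (Fin 3 → F)) (x : Fin 3 → F) :
    x = b.coord 0 x • b 0 + b.coord 1 x • b 1 + b.coord 2 x • b 2 := by
  have h := b.sum_repr x
  rw [Fin.sum_univ_three] at h
  exact h.symm

lemma card_lin [Fintype F] {v : Fin 3 → F} (hv : v ≠ 0) :
    Nat.card {L : (Fin 3 → F) →ₗ[F] F // L v = 1} = Fintype.card F ^ 2 := by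
  obtain ⟨b, rfl⟩ := exists_basis_one hv
  let e : {L : (Fin 3 → F) →ₗ[F] F // L (b 0) = 1} ≃ F × F :=
    { toFun := fun L => (L.1 (b 1), L.1 (b 2))
      invFun := fun s => ⟨b.constr F ![1, s.1, s.2], by simp⟩
      left_inv := by
        rintro ⟨L, hL⟩
        apply Subtype.ext
        apply b.ext
        intro i
        fin_cases i <;> simp [hL]
      right_inv := by
        rintro ⟨s, t⟩
        simp }
  rw [Nat.card_congr e, Nat.card_prod, Nat.card_eq_fintype_card, sq]

lemma card_M [Fintype F] [Fintype K] {v : Fin 3 → F} (hv : v ≠ 0) :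
    (Nat.card {M : (Fin 3 → F) →ₗ[F] K // M v = 0 ∧ ∀ x, M x = 0 → ∃ a : F, a • v = x} : ℤ)
      = ((Fintype.card K : ℤ) - Fintype.card F) * ((Fintype.card K : ℤ) - 1) := by
  obtain ⟨b, rfl⟩ := exists_basis_one hv
  let e : {M : (Fin 3 → F) →ₗ[F] K // M (b 0) = 0 ∧ ∀ x, M x = 0 → ∃ a : F, a • b 0 = x}
      ≃ {s : Fin 2 → K // LinearIndependent F s} :=
    { toFun := fun M => ⟨![M.1 (b 1), M.1 (b 2)], by
        rw [LinearIndependent.pair_iff]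
        intro s t hst
        obtain ⟨a, ha⟩ := M.2.2 (s • b 1 + t • b 2) (by simpa using hst)
        have h1 := congrArg (b.coord 1) ha
        have h2 := congrArg (b.coord 2) ha
        simp at h1 h2
        exact ⟨h1.symm, h2.symm⟩⟩
      invFun := fun s => ⟨b.constr F ![0, s.1 0, s.1 1], by
        refine ⟨by simp, ?_⟩
        intro x hx
        have hs : LinearIndependent F ![s.1 0, s.1 1] := by
          have : s.1 = ![s.1 0, s.1 1] := by ext i; fin_cases i <;> rfl
          rw [← this]; exact s.2
        rw [LinearIndependent.pair_iff] at hs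
        have hx' := basis_expand b x
        rw [hx'] at hx
        simp only [map_add, map_smul, Basis.constr_basis] at hx
        obtain ⟨h1, h2⟩ := hs (b.coord 1 x) (b.coord 2 x) (by simpa using hx)
        rw [h1, h2] at hx'
        exact ⟨b.coord 0 x, by simpa using hx'.symm⟩⟩
      left_inv := by
        rintro ⟨M, hM, hM'⟩
        apply Subtype.ext
        apply b.ext
        intro i
        fin_cases i <;> simp [hM]
      right_inv := by
        rintro ⟨s, hs⟩
        apply Subtype.ext
        ext i
        fin_cases i <;> simp }
  rw [Nat.card_congr e]
  have hK : Fintype.card K = Fintype.card F ^ finrank F K := card_eq_pow_finrank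
  have hpos : 0 < finrank F K := finrank_pos
  have hF : 1 < Fintype.card F := Fintype.one_lt_card
  by_cases h1 : finrank F K = 1
  · have : IsEmpty {s : Fin 2 → K // LinearIndependent F s} := by
      constructor
      rintro ⟨s, hs⟩
      have := hs.fintype_card_le_finrank
      simp [h1] at this
    rw [hK, h1]
    simp
  · rw [card_linearIndependent (by omega), Fin.prod_univ_two, ← hK]
    have h2 : Fintype.card F ≤ Fintype.card K := by
      rw [hK]; exact Nat.le_self_pow (by omega) _
    push_cast [Fin.val_zero, Fin.val_one, pow_zero, pow_one]
    rw [Nat.cast_sub (by omega), Nat.cast_sub (by omega)]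
    push_cast
    ring

lemma rep_ne (rep : Plane F → (Fin 3 → F))
    (hrep : ∀ p : Plane F, ∃ h : rep p ≠ 0, Projectivization.mk F (rep p) h = p)
    (p : Plane F) : rep p ≠ 0 := (hrep p).1

lemma rep_inj (rep : Plane F → (Fin 3 → F))
    (hrep : ∀ p : Plane F, ∃ h : rep p ≠ 0, Projectivization.mk F (rep p) h = p)
    {p p' : Plane F} {a : F} (h : a • rep p = rep p') : p' = p := by
  obtain ⟨h1, h2⟩ := hrep p
  obtain ⟨h3, h4⟩ := hrep p'
  rw [← h2, ← h4, Projectivization.mk_eq_mk_iff']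
  exact ⟨a, h⟩

lemma exists_rep (rep : Plane F → (Fin 3 → F))
    (hrep : ∀ p : Plane F, ∃ h : rep p ≠ 0, Projectivization.mk F (rep p) h = p)
    {x : Fin 3 → F} (hx : x ≠ 0) : ∃ (p : Plane F) (c : F), c ≠ 0 ∧ x = c • rep p := by
  obtain ⟨h1, h2⟩ := hrep (Projectivization.mk F x hx)
  obtain ⟨a, ha⟩ := (Projectivization.mk_eq_mk_iff' F _ _ _ _).1 h2.symm
  refine ⟨_, a, ?_, ha.symm⟩
  rintro rfl
  exact hx (by rw [← ha, zero_smul])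

lemma card_pts [Fintype F] (rep : Plane F → (Fin 3 → F))
    (hrep : ∀ p : Plane F, ∃ h : rep p ≠ 0, Projectivization.mk F (rep p) h = p)
    (L : (Fin 3 → F) →ₗ[F] F) {v0 : Fin 3 → F} (h0 : L v0 = 1) :
    Nat.card {p // L (rep p) ≠ 0} = Fintype.card F ^ 2 := by
  have hs : Function.Surjective L := fun a => ⟨a • v0, by simp [h0]⟩
  have hk : finrank F (LinearMap.ker L) = 2 := by
    have := L.finrank_range_add_finrank_ker
    rw [LinearMap.range_eq_top.2 hs, finrank_top] at this
    simp at this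
    omega
  have hc : Nat.card (LinearMap.ker L) = Fintype.card F ^ 2 := by
    rw [← hk, ← Nat.card_eq_fintype_card]
    exact natCard_eq_pow_finrank
  rw [← hc]
  refine Nat.card_eq_of_bijective
    (fun p => (⟨(L (rep p.1))⁻¹ • rep p.1 - v0, ?_⟩ : LinearMap.ker L)) ⟨?_, ?_⟩
  · simp [h0, p.2]
  · rintro ⟨p, hp⟩ ⟨p', hp'⟩ h
    have h' : (L (rep p))⁻¹ • rep p = (L (rep p'))⁻¹ • rep p' := by
      simpa using congrArg Subtype.val h
    apply Subtype.ext
    apply Eq.symm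
    apply rep_inj rep hrep (a := L (rep p') * (L (rep p))⁻¹)
    rw [mul_smul, h', smul_smul, mul_inv_cancel₀ hp', one_smul]
  · rintro ⟨k, hk⟩
    have hk' : L k = 0 := hk
    have hL : L (k + v0) = 1 := by simp [hk', h0]
    obtain ⟨p, c, hc, hx⟩ := exists_rep rep hrep (x := k + v0) (by
      intro h; rw [h] at hL; simp at hL)
    rw [hx, map_smul, smul_eq_mul] at hL
    refine ⟨⟨p, ?_⟩, ?_⟩
    · intro h; rw [h] at hL; simp at hL
    · apply Subtype.ext
      simp only
      rw [← eq_inv_of_mul_eq_one_left hL, ← hx]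
      simp

lemma quad_two (Q : QuadraticMap F (Fin 3 → F) K) (a c : F) (x y : Fin 3 → F) :
    Q (a • x + c • y) = (a * a) • Q x + (c * c) • Q y + (a * c) • QuadraticMap.polar Q x y := by
  rw [QuadraticMap.map_add Q, QuadraticMap.map_smul, QuadraticMap.map_smul,
    QuadraticMap.polar_smul_left, QuadraticMap.polar_smul_right, smul_smul]

lemma deg_one {f : MvPolynomial (Fin 3) K} (hf : f ∈ homogeneousSubmodule (Fin 3) K 1) :
    ∃ l : (Fin 3 → F) →ₗ[F] K, ∀ x, aeval (fun i => algebraMap F K (x i)) f = l x := by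
  rw [homogeneousSubmodule_one_eq_span_X] at hf
  induction hf using Submodule.span_induction with
  | mem f h =>
    obtain ⟨i, rfl⟩ := h
    exact ⟨(Algebra.linearMap F K).comp (LinearMap.proj i), by simp⟩
  | zero => exact ⟨0, by simp⟩
  | add f g _ _ hf hg =>
    obtain ⟨l, hl⟩ := hf
    obtain ⟨m, hm⟩ := hg
    exact ⟨l + m, fun x => by rw [map_add, hl, hm]; rfl⟩
  | smul c f _ hf =>
    obtain ⟨l, hl⟩ := hf
    exact ⟨c • l, fun x => by rw [map_smul, hl]; rfl⟩

lemma deg_two {f : MvPolynomial (Fin 3) K} (hf : f ∈ homogeneousSubmodule (Fin 3) K 2) :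
    ∃ Q : QuadraticMap F (Fin 3 → F) K, ∀ x, aeval (fun i => algebraMap F K (x i)) f = Q x := by
  rw [← homogeneousSubmodule_one_pow, pow_two] at hf
  induction hf using Submodule.mul_induction_on' with
  | mem_mul_mem f hf g hg =>
    obtain ⟨l, hl⟩ := deg_one (F := F) hf
    obtain ⟨m, hm⟩ := deg_one (F := F) hg
    exact ⟨QuadraticMap.linMulLin l m, fun x => by rw [map_mul, hl, hm]; rfl⟩
  | add f _ g _ hf hg =>
    obtain ⟨l, hl⟩ := hf
    obtain ⟨m, hm⟩ := hg
    exact ⟨l + m, fun x => by rw [map_add, hl, hm]; rfl⟩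

lemma lin_poly (l : (Fin 3 → F) →ₗ[F] K) :
    ∃ f ∈ homogeneousSubmodule (Fin 3) K 1,
      ∀ x, aeval (fun i => algebraMap F K (x i)) f = l x := by
  refine ⟨∑ i, C (l (Pi.single i 1)) * X i, ?_, ?_⟩
  · apply Submodule.sum_mem
    intro i _
    rw [mem_homogeneousSubmodule]
    exact (isHomogeneous_X _ _).C_mul _
  · intro x
    conv_rhs => rw [pi_eq_sum_univ' x, map_sum]
    simp only [map_sum, map_mul, map_smul, aeval_X, algHom_C, Algebra.algebraMap_self,
      RingHom.id_apply, Algebra.smul_def (A := K)]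
    exact Finset.sum_congr rfl fun i _ => mul_comm _ _

lemma mul_mem_code (rep : Plane F → (Fin 3 → F)) (L : (Fin 3 → F) →ₗ[F] F)
    (M : (Fin 3 → F) →ₗ[F] K) : (fun p => L (rep p) • M (rep p)) ∈ VeroneseCodeExt K rep := by
  obtain ⟨f, hf, hf'⟩ := lin_poly ((Algebra.linearMap F K).comp L)
  obtain ⟨g, hg, hg'⟩ := lin_poly M
  refine ⟨f * g, ?_, ?_⟩
  · exact IsHomogeneous.mul hf hg
  · ext p
    change aeval (fun i => algebraMap F K (rep p i)) (f * g) = _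
    rw [map_mul, hf', hg', Algebra.smul_def]
    rfl

lemma quad_three (Q : QuadraticMap F (Fin 3 → F) K) (a c d : F) (x y z : Fin 3 → F) :
    Q (a • x + c • y + d • z) = (a * a) • Q x + (c * c) • Q y + (d * d) • Q z
      + (a * c) • QuadraticMap.polar Q x y + (a * d) • QuadraticMap.polar Q x z
      + (c * d) • QuadraticMap.polar Q y z := by
  rw [QuadraticMap.map_add Q, quad_two, QuadraticMap.map_smul, QuadraticMap.polar_add_left,
    QuadraticMap.polar_smul_left, QuadraticMap.polar_smul_right,
    QuadraticMap.polar_smul_left, QuadraticMap.polar_smul_right, smul_smul, smul_smul]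
  abel

/-- The key geometric fact: a quadratic map with at least `q + 2` projective zeros
vanishes identically on some line. -/
lemma exists_line [Fintype F] (rep : Plane F → (Fin 3 → F))
    (hrep : ∀ p : Plane F, ∃ h : rep p ≠ 0, Projectivization.mk F (rep p) h = p)
    (hq : 4 ≤ Fintype.card F) (Q : QuadraticMap F (Fin 3 → F) K)
    (hc : Fintype.card F + 2 ≤ Nat.card {p // Q (rep p) = 0}) :
    ∃ x y, x ≠ 0 ∧ (∀ a : F, a • x ≠ y) ∧ Q x = 0 ∧ Q y = 0 ∧ QuadraticMap.polar Q x y = 0 := by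
  by_contra! H
  have hfin : Finite (Plane F) := by infer_instance
  have : Fintype {p // Q (rep p) = 0} := Fintype.ofFinite _
  obtain ⟨emb⟩ : Nonempty (Fin 5 ↪ {p // Q (rep p) = 0}) := by
    apply Function.Embedding.nonempty_of_card_le
    rw [← Nat.card_eq_fintype_card (α := {p // Q (rep p) = 0}), Fintype.card_fin]
    omega
  obtain ⟨r, hr⟩ : ∃ r : Fin 5 → (Fin 3 → F), ∀ i, r i = rep (emb i).1 := ⟨_, fun _ => rfl⟩
  have hr0 : ∀ i, Q (r i) = 0 := fun i => by rw [hr]; exact (emb i).2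
  have hrn : ∀ i, r i ≠ 0 := fun i => by rw [hr]; exact rep_ne rep hrep _
  have hne : ∀ i j, i ≠ j → ∀ a : F, a • r i ≠ r j := by
    intro i j hij a h
    rw [hr, hr] at h
    exact hij (emb.injective (Subtype.ext (rep_inj rep hrep h))).symm
  have hP : ∀ i j, i ≠ j → QuadraticMap.polar Q (r i) (r j) ≠ 0 := fun i j hij =>
    H _ _ (hrn i) (hne i j hij) (hr0 i) (hr0 j)
  have key3 : ∀ i j k, i ≠ j → i ≠ k → j ≠ k → ∀ a c : F, a • r i + c • r j ≠ r k := by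
    intro i j k hij hik hjk a c h
    have h1 := quad_two Q a c (r i) (r j)
    rw [h, hr0, hr0, hr0, smul_zero, smul_zero, zero_add, zero_add, eq_comm, smul_eq_zero] at h1
    rcases h1 with h1 | h1
    · rcases mul_eq_zero.1 h1 with h1 | h1
      · rw [h1, zero_smul, zero_add] at h
        exact hne j k hjk _ h
      · rw [h1, zero_smul, add_zero] at h
        exact hne i k hik _ h
    · exact hP i j hij h1
  obtain ⟨b, hb0, hb1, hb2⟩ := exists_basis_triple (hrn 0) (hne 0 1 (by decide))
    (key3 0 1 2 (by decide) (by decide) (by decide))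
  have coords : ∀ k, 0 ≠ k → 1 ≠ k → 2 ≠ k → ∃ x y z : F, x ≠ 0 ∧ y ≠ 0 ∧ z ≠ 0 ∧
      r k = x • r 0 + y • r 1 + z • r 2 := by
    intro k h0 h1 h2
    have h := basis_expand b (r k)
    rw [hb0, hb1, hb2] at h
    refine ⟨_, _, _, ?_, ?_, ?_, h⟩
    · intro hz
      rw [hz, zero_smul, zero_add] at h
      exact key3 1 2 k (by decide) h1 h2 _ _ h.symm
    · intro hz
      rw [hz, zero_smul, add_zero] at h
      exact key3 0 2 k (by decide) h0 h2 _ _ h.symm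
    · intro hz
      rw [hz, zero_smul, add_zero] at h
      exact key3 0 1 k (by decide) h0 h1 _ _ h.symm
  obtain ⟨x, y, z, hx, hy, hz, h3⟩ := coords 3 (by decide) (by decide) (by decide)
  obtain ⟨x', y', z', hx', hy', hz', h4⟩ := coords 4 (by decide) (by decide) (by decide)
  have e3 := quad_three Q x y z (r 0) (r 1) (r 2)
  have e4 := quad_three Q x' y' z' (r 0) (r 1) (r 2)
  rw [← h3] at e3
  rw [← h4] at e4
  simp only [hr0, smul_zero, zero_add] at e3 e4
  obtain ⟨α, hα⟩ : ∃ α, α = y * y' * (x * z' - x' * z) := ⟨_, rfl⟩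
  obtain ⟨β, hβ⟩ : ∃ β, β = z * z' * (x * y' - x' * y) := ⟨_, rfl⟩
  obtain ⟨w, hw⟩ : ∃ w, w = α • r 1 + β • r 2 := ⟨_, rfl⟩
  have hNw : QuadraticMap.polar Q (r 0) w = 0 := by
    rw [hw, QuadraticMap.polar_add_right, QuadraticMap.polar_smul_right,
      QuadraticMap.polar_smul_right, hα, hβ]
    simp only [Algebra.smul_def, map_mul, map_sub] at e3 e4 ⊢
    linear_combination (-(algebraMap F K y' * algebraMap F K z')) * e3
      + (algebraMap F K y * algebraMap F K z) * e4
  have hwv : ∀ a : F, a • r 0 ≠ w := by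
    intro a ha
    rw [hw, ← hb0, ← hb1, ← hb2] at ha
    have h1 := congrArg (b.coord 1) ha
    have h2 := congrArg (b.coord 2) ha
    simp at h1 h2
    rw [hα] at h1
    rw [hβ] at h2
    have h1' : x * z' = x' * z := by
      simpa [hy, hy', sub_eq_zero] using h1.symm
    have h2' : x * y' = x' * y := by
      simpa [hz, hz', sub_eq_zero] using h2.symm
    apply hne 3 4 (by decide) (x' / x)
    rw [h3, h4, smul_add, smul_add, smul_smul, smul_smul, smul_smul]
    congr 2
    · field_simp
    · congr 1; field_simp; exact h2'.symm
    · congr 1; field_simp; exact h1'.symm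
  have hQw : Q w ≠ 0 := fun h => H _ _ (hrn 0) hwv (hr0 0) h hNw
  obtain ⟨b', hb0', hb1'⟩ := exists_basis_pair (hrn 0) hwv
  have hD : ∀ p, Q (rep p) = 0 → p ≠ (emb 0).1 → b'.coord 2 (rep p) ≠ 0 := by
    intro p hp hpne hD
    have h := basis_expand b' (rep p)
    rw [hD, zero_smul, add_zero, hb0', hb1'] at h
    have h1 := quad_two Q (b'.coord 0 (rep p)) (b'.coord 1 (rep p)) (r 0) w
    rw [← h, hp, hr0, hNw, smul_zero, smul_zero, zero_add, add_zero, eq_comm, smul_eq_zero] at h1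
    rcases h1 with h1 | h1
    · rw [mul_self_eq_zero.1 h1, zero_smul, add_zero, hr] at h
      exact hpne (rep_inj rep hrep h.symm)
    · exact hQw h1
  classical
  let f : {p // Q (rep p) = 0} → Option F := fun p =>
    if p.1 = (emb 0).1 then none else some (b'.coord 1 (rep p.1) / b'.coord 2 (rep p.1))
  have hf : Function.Injective f := by
    rintro ⟨p, hp⟩ ⟨p', hp'⟩ h
    apply Subtype.ext
    simp only [f] at h ⊢
    split_ifs at h with h1 h2 h2
    · rw [h1, h2]
    · have hDp := hD p hp h1
      have hDp' := hD p' hp' h2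
      by_contra hpp
      have hpol := H (rep p) (rep p') (rep_ne rep hrep _)
        (fun a ha => hpp (rep_inj rep hrep ha).symm) hp hp'
      have h5 := Option.some.inj h
      rw [div_eq_div_iff hDp hDp'] at h5
      have h6 := quad_two Q (b'.coord 2 (rep p')) (- b'.coord 2 (rep p)) (rep p) (rep p')
      have h7 := basis_expand b'
        (b'.coord 2 (rep p') • rep p + (- b'.coord 2 (rep p)) • rep p')
      have h8 : b'.coord 2
        (b'.coord 2 (rep p') • rep p + (- b'.coord 2 (rep p)) • rep p') = 0 := by
        rw [map_add, map_smul, map_smul, smul_eq_mul, smul_eq_mul]; ring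
      have h9 : b'.coord 1
        (b'.coord 2 (rep p') • rep p + (- b'.coord 2 (rep p)) • rep p') = 0 := by
        rw [map_add, map_smul, map_smul, smul_eq_mul, smul_eq_mul]
        linear_combination h5
      rw [h8, h9, zero_smul, zero_smul, add_zero, add_zero, hb0'] at h7
      rw [h7, QuadraticMap.map_smul, hr0, hp, hp'] at h6
      simp only [smul_zero, zero_add] at h6
      rcases smul_eq_zero.1 h6.symm with h6 | h6
      · rcases mul_eq_zero.1 h6 with h6 | h6
        · exact hDp' h6
        · exact hDp (neg_eq_zero.1 h6)
      · exact hpol h6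
  have := Nat.card_le_card_of_injective f hf
  rw [Nat.card_eq_fintype_card (α := Option F), Fintype.card_option] at this
  omega

lemma factor (Q : QuadraticMap F (Fin 3 → F) K) {x y : Fin 3 → F} (hx : x ≠ 0)
    (hy : ∀ a : F, a • x ≠ y) (h1 : Q x = 0) (h2 : Q y = 0)
    (h3 : QuadraticMap.polar Q x y = 0) :
    ∃ (L : (Fin 3 → F) →ₗ[F] F) (M : (Fin 3 → F) →ₗ[F] K) (v0 : Fin 3 → F), L v0 = 1 ∧
      ∀ z, Q z = L z • M z := by
  obtain ⟨b, rfl, rfl⟩ := exists_basis_pair hx hy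
  refine ⟨b.coord 2, Q.polarBilin (b 2) - (b.coord 2).smulRight (Q (b 2)), b 2, by simp, ?_⟩
  intro z
  have hz := basis_expand b z
  have e : Q z = _ := (congrArg Q hz).trans (quad_three Q _ _ _ _ _ _)
  have e2 : Q.polarBilin (b 2) z = b.coord 0 z • QuadraticMap.polar Q (b 0) (b 2)
      + b.coord 1 z • QuadraticMap.polar Q (b 1) (b 2) + b.coord 2 z • (Q (b 2) + Q (b 2)) := by
    conv_lhs => rw [hz]
    rw [map_add, map_add, map_smul, map_smul, map_smul]
    simp only [QuadraticMap.polarBilin_apply_apply]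
    rw [QuadraticMap.polar_self, two_nsmul, QuadraticMap.polar_comm Q (b 2) (b 0),
      QuadraticMap.polar_comm Q (b 2) (b 1)]
  rw [e, h1, h2, h3, LinearMap.sub_apply, e2, LinearMap.smulRight_apply]
  simp only [Algebra.smul_def, map_mul]
  ring


/-- The set of triples parametrizing the words of weight `q ^ 2 - 1`. -/
abbrev Trip (K : Type*) [Field K] [Algebra F K] (rep : Plane F → (Fin 3 → F)) :=
  Σ p : Plane F, {L : (Fin 3 → F) →ₗ[F] F // L (rep p) = 1} ×
    {M : (Fin 3 → F) →ₗ[F] K // M (rep p) = 0 ∧ ∀ x, M x = 0 → ∃ a : F, a • rep p = x}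

lemma card_plane [Fintype F] :
    Nat.card (Plane F) = Fintype.card F ^ 2 + Fintype.card F + 1 := by
  rw [Projectivization.card_of_finrank F (Fin 3 → F) (n := 3) (by simp)]
  simp [Finset.sum_range_succ]
  ring

lemma card_trip [Fintype F] [Fintype K] (rep : Plane F → (Fin 3 → F))
    (hrep : ∀ p : Plane F, ∃ h : rep p ≠ 0, Projectivization.mk F (rep p) h = p) :
    (Nat.card (Trip K rep) : ℤ) =
      ((Fintype.card F : ℤ) ^ 2 + Fintype.card F + 1) * (Fintype.card F : ℤ) ^ 2 *
        ((Fintype.card K : ℤ) - Fintype.card F) * ((Fintype.card K : ℤ) - 1) := by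
  have hfin : Finite (Plane F) := by infer_instance
  have : Fintype (Plane F) := Fintype.ofFinite _
  have hM : Finite ((Fin 3 → F) →ₗ[F] K) := Module.finite_of_finite F
  have hL : Finite ((Fin 3 → F) →ₗ[F] F) := Module.finite_of_finite F
  rw [Nat.card_sigma]
  push_cast [Nat.card_prod]
  rw [Finset.sum_congr rfl (fun p _ => by
    rw [card_lin (rep_ne rep hrep p), card_M (rep_ne rep hrep p)])]
  rw [Finset.sum_const, Finset.card_univ, ← Nat.card_eq_fintype_card, card_plane]
  push_cast [nsmul_eq_mul]
  ring

lemma wt_trip [Fintype F] (rep : Plane F → (Fin 3 → F))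
    (hrep : ∀ p : Plane F, ∃ h : rep p ≠ 0, Projectivization.mk F (rep p) h = p)
    (t : Trip K rep) :
    wt (fun p => t.2.1.1 (rep p) • t.2.2.1 (rep p)) = Fintype.card F ^ 2 - 1 := by
  obtain ⟨p, ⟨L, hL⟩, ⟨M, hM, hM'⟩⟩ := t
  have hc : Set.ncard {p | L (rep p) ≠ 0} = Fintype.card F ^ 2 := card_pts rep hrep L hL
  have : {p | L (rep p) • M (rep p) ≠ 0} = {p | L (rep p) ≠ 0} \ {p} := by
    ext p'
    simp only [Set.mem_ofPred_eq, Set.mem_sdiff, Set.mem_singleton_iff, smul_ne_zero_iff]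
    refine and_congr_right fun h => not_congr ⟨fun h => ?_, fun h => by rw [h, hM]⟩
    obtain ⟨a, ha⟩ := hM' _ h
    exact rep_inj rep hrep ha
  change Set.ncard {p | L (rep p) • M (rep p) ≠ 0} = _
  rw [this, Set.ncard_sdiff_singleton_of_mem (by simp [hL]), hc]

lemma eq_of_rep {rep : Plane F → (Fin 3 → F)}
    (hrep : ∀ p : Plane F, ∃ h : rep p ≠ 0, Projectivization.mk F (rep p) h = p)
    {L L' : (Fin 3 → F) →ₗ[F] F} {M M' : (Fin 3 → F) →ₗ[F] K}
    (h : ∀ p, L (rep p) • M (rep p) = L' (rep p) • M' (rep p)) (x : Fin 3 → F) :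
    L x • M x = L' x • M' x := by
  by_cases hx : x = 0
  · simp [hx]
  obtain ⟨p, c, -, rfl⟩ := exists_rep rep hrep hx
  simp only [map_smul, smul_eq_mul]
  have e := h p
  simp only [Algebra.smul_def, map_mul] at e ⊢
  linear_combination (algebraMap F K c) ^ 2 * e

lemma point_unique (hF : ∃ c : F, c ≠ 0 ∧ c ≠ 1) {v v' : Fin 3 → F}
    {L L' : (Fin 3 → F) →ₗ[F] F} {M M' : (Fin 3 → F) →ₗ[F] K} (hv : v ≠ 0)
    (h : ∀ x, L x • M x = L' x • M' x) (hL : L v = 1) (hL' : L' v' = 1)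
    (hM : ∀ x, M x = 0 → ∃ a : F, a • v = x)
    (hM0' : M' v' = 0) (hM' : ∀ x, M' x = 0 → ∃ a : F, a • v' = x) : ∃ a : F, a • v = v' := by
  by_contra! hne
  have h1 : L v' = 0 := by
    have := h v'
    rw [hM0', smul_zero, smul_eq_zero] at this
    rcases this with h | h
    · exact h
    · obtain ⟨a, ha⟩ := hM _ h
      exact absurd ha (hne a)
  obtain ⟨b, hb0, hb1⟩ := exists_basis_pair hv hne
  obtain ⟨w, hw⟩ : ∃ w, w = b 2 - L (b 2) • v := ⟨_, rfl⟩
  have hLw : L w = 0 := by simp [hw, hL]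
  have hMw : M' w ≠ 0 := by
    intro h0
    obtain ⟨a, ha⟩ := hM' _ h0
    rw [hw, ← hb0, ← hb1] at ha
    have := congrArg (b.coord 2) ha
    simp at this
  have key : ∀ c : F, c ≠ 0 → 1 + c * L' w = 0 := by
    intro c hc
    have := h (v' + c • w)
    simp only [map_add, map_smul, h1, hLw, hM0', hL', smul_eq_mul, mul_zero, add_zero, zero_smul,
      zero_add] at this
    rcases smul_eq_zero.1 this.symm with h | h
    · exact h
    · rcases smul_eq_zero.1 h with h | h
      · exact absurd h hc
      · exact absurd h hMw
  obtain ⟨c, hc0, hc1⟩ := hF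
  have k1 := key 1 one_ne_zero
  have k2 := key c hc0
  apply hc1
  linear_combination c * k1 - k2

lemma lin_unique {v : Fin 3 → F}
    {L L' : (Fin 3 → F) →ₗ[F] F} {M M' : (Fin 3 → F) →ₗ[F] K}
    (h : ∀ x, L x • M x = L' x • M' x) (hL : L v = 1) (hL' : L' v = 1)
    (hM0 : M v = 0) (hM0' : M' v = 0) (hM' : ∀ x, M' x = 0 → ∃ a : F, a • v = x) :
    L = L' ∧ M = M' := by
  have hk : ∀ x, L x = 0 → L' x = 0 := by
    intro x hx
    have h1 := h x
    rw [hx, zero_smul, eq_comm, smul_eq_zero] at h1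
    rcases h1 with h1 | h1
    · exact h1
    · obtain ⟨a, rfl⟩ := hM' _ h1
      simp [hL] at hx
      simp [hx]
  have hLL : L = L' := by
    refine LinearMap.ext fun x => ?_
    have := hk (x - L x • v) (by simp [hL])
    simp [hL', sub_eq_zero] at this
    exact this.symm
  subst hLL
  refine ⟨rfl, ?_⟩
  have h1 : ∀ x, L x ≠ 0 → M x = M' x := fun x hx => smul_right_injective K hx (h x)
  refine LinearMap.ext fun x => ?_
  by_cases hx : L x = 0
  · have := h1 (x + v) (by simp [hx, hL])
    simpa [hM0, hM0'] using this
  · exact h1 x hx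

lemma surj [Fintype F] (rep : Plane F → (Fin 3 → F))
    (hrep : ∀ p : Plane F, ∃ h : rep p ≠ 0, Projectivization.mk F (rep p) h = p)
    (hq : 4 ≤ Fintype.card F) (Q : QuadraticMap F (Fin 3 → F) K)
    (hw : wt (fun p => Q (rep p)) = Fintype.card F ^ 2 - 1) :
    ∃ t : Trip K rep, ∀ p, t.2.1.1 (rep p) • t.2.2.1 (rep p) = Q (rep p) := by
  have hfin : Finite (Plane F) := by infer_instance
  have hw' : Set.ncard {p | Q (rep p) ≠ 0} = Fintype.card F ^ 2 - 1 := hw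
  have hpos : 1 ≤ Fintype.card F ^ 2 := Nat.one_le_pow _ _ (by omega)
  have hz : Fintype.card F + 2 ≤ Nat.card {p // Q (rep p) = 0} := by
    have h1 := Set.ncard_add_ncard_compl {p | Q (rep p) ≠ 0}
    have h2 : {p | Q (rep p) ≠ 0}ᶜ = {p | Q (rep p) = 0} := by ext; simp
    rw [h2, hw', card_plane] at h1
    change _ ≤ Set.ncard {p | Q (rep p) = 0}
    omega
  obtain ⟨x, y, hx, hxy, h1, h2, h3⟩ := exists_line rep hrep hq Q hz
  obtain ⟨L, M, v0, hv0, hQ⟩ := factor Q hx hxy h1 h2 h3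
  have hA : Set.ncard {p | L (rep p) ≠ 0} = Fintype.card F ^ 2 := card_pts rep hrep L hv0
  have hsub : {p | Q (rep p) ≠ 0} ⊆ {p | L (rep p) ≠ 0} := by
    intro p hp hL
    apply hp
    rw [hQ, hL, zero_smul]
  have hone : Set.ncard ({p | L (rep p) ≠ 0} \ {p | Q (rep p) ≠ 0}) = 1 := by
    rw [Set.ncard_sdiff hsub, hA, hw']
    omega
  obtain ⟨p, hp⟩ := Set.ncard_eq_one.1 hone
  have hp1 : ∀ p', L (rep p') ≠ 0 → M (rep p') = 0 → p' = p := by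
    intro p' h1 h2
    have : p' ∈ ({p | L (rep p) ≠ 0} \ {p | Q (rep p) ≠ 0}) := ⟨h1, by simp [hQ, h2]⟩
    rw [hp] at this
    exact this
  have hp2 : p ∈ ({p | L (rep p) ≠ 0} \ {p | Q (rep p) ≠ 0}) := by rw [hp]; rfl
  have hLp : L (rep p) ≠ 0 := hp2.1
  have hMp : M (rep p) = 0 := by
    have : Q (rep p) = 0 := not_not.1 hp2.2
    rw [hQ, smul_eq_zero] at this
    exact this.resolve_left hLp
  have hu : ∀ x, L x ≠ 0 → M x = 0 → ∃ a : F, a • rep p = x := by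
    intro x hx1 hx2
    obtain ⟨p', c, hc, rfl⟩ := exists_rep rep hrep (x := x) (by rintro rfl; simp at hx1)
    have := hp1 p' (by intro h; simp [h] at hx1) (by
      rw [map_smul, smul_eq_zero] at hx2
      exact hx2.resolve_left hc)
    exact ⟨c, by rw [this]⟩
  have hker : ∀ x, M x = 0 → ∃ a : F, a • rep p = x := by
    intro x hx
    by_cases hLx : L x = 0
    · obtain ⟨a, ha⟩ := hu (x + rep p) (by simpa [hLx] using hLp) (by simp [hx, hMp])
      exact ⟨a - 1, by rw [sub_smul, ha, one_smul, add_sub_cancel_right]⟩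
    · exact hu x hLx hx
  refine ⟨⟨p, ⟨(L (rep p))⁻¹ • L, by simp [hLp]⟩, ⟨L (rep p) • M, by simp [hMp], ?_⟩⟩, ?_⟩
  · intro x hx
    rw [LinearMap.smul_apply, smul_eq_zero] at hx
    exact hker x (hx.resolve_left hLp)
  · intro p'
    simp only [LinearMap.smul_apply, smul_eq_mul]
    rw [smul_smul, hQ]
    congr 1
    field_simp

lemma main [Fintype F] (hq : 4 ≤ Fintype.card F) (rep : Plane F → (Fin 3 → F))
    (hrep : ∀ p : Plane F, ∃ h : rep p ≠ 0, Projectivization.mk F (rep p) h = p)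
    (K : Type*) [Field K] [Fintype K] [Algebra F K] :
    (Nat.card {g : Plane F → K | g ∈ VeroneseCodeExt K rep ∧
        wt g = Fintype.card F ^ 2 - 1} : ℤ) =
      ((Fintype.card F : ℤ) ^ 2 + Fintype.card F + 1) * (Fintype.card F : ℤ) ^ 2 *
        ((Fintype.card K : ℤ) - Fintype.card F) * ((Fintype.card K : ℤ) - 1) := by
  rw [← card_trip rep hrep]
  congr 1
  symm
  have hF : ∃ c : F, c ≠ 0 ∧ c ≠ 1 := by
    classical
    by_contra! h
    have : (Finset.univ : Finset F) ⊆ {0, 1} := by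
      intro c _
      by_cases hc : c = 0
      · simp [hc]
      · simp [h c hc]
    have := Finset.card_le_card this
    have h2 : ({0, 1} : Finset F).card ≤ 2 := Finset.card_le_two
    rw [Finset.card_univ] at this
    omega
  refine Nat.card_eq_of_bijective (fun t : Trip K rep =>
    (⟨fun p => t.2.1.1 (rep p) • t.2.2.1 (rep p), mul_mem_code rep _ _, wt_trip rep hrep t⟩ :
      {g : Plane F → K | g ∈ VeroneseCodeExt K rep ∧ wt g = Fintype.card F ^ 2 - 1})) ⟨?_, ?_⟩
  · rintro ⟨p, ⟨L, hL⟩, ⟨M, hM, hM'⟩⟩ ⟨p', ⟨L', hL'⟩, ⟨M', hN, hN'⟩⟩ h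
    have h1 : ∀ x, L x • M x = L' x • M' x :=
      eq_of_rep hrep (fun p => congrFun (congrArg Subtype.val h) p)
    obtain ⟨a, ha⟩ := point_unique hF (rep_ne rep hrep p) h1 hL hL' hM' hN hN'
    obtain rfl := rep_inj rep hrep ha
    obtain ⟨rfl, rfl⟩ := lin_unique h1 hL hL' hM hN hN'
    rfl
  · rintro ⟨g, ⟨f, hf, rfl⟩, hg⟩
    obtain ⟨Q, hQ⟩ := deg_two (F := F) hf
    have e : (LinearMap.pi fun p : Plane F =>
        (MvPolynomial.aeval (R := K) (fun i => algebraMap F K (rep p i))).toLinearMap) f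
          = fun p => Q (rep p) := by
      ext p
      exact hQ (rep p)
    rw [e] at hg
    obtain ⟨t, ht⟩ := surj rep hrep hq Q hg
    refine ⟨t, Subtype.ext ?_⟩
    exact (funext ht).trans e.symm

end VeroneseAux

theorem veronese_ext_count_weight_qsq_sub_one
    {F : Type*} [Field F] [Fintype F] (q : ℕ) (hq : Fintype.card F = q) (hq4 : 4 ≤ q)
    (rep : Plane F → (Fin 3 → F))
    (hrep : ∀ p : Plane F, ∃ h : rep p ≠ 0, Projectivization.mk F (rep p) h = p)
    (K : Type*) [Field K] [Fintype K] [Algebra F K] :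
    (Nat.card {g : Plane F → K | g ∈ VeroneseCodeExt K rep ∧ wt g = q ^ 2 - 1} : ℤ) =
      ((q : ℤ) ^ 2 + q + 1) * q ^ 2 * ((Fintype.card K : ℤ) - q) *
        ((Fintype.card K : ℤ) - 1) := by
  subst hq
  exact VeroneseAux.main hq4 rep hrep K
end
end

section
/- Let q ≥ 4 be a prime power and let K be a finite field extension of F, with Z = |K|. Then the number of codewords g of the extended Veronese code C_q(K) with wt(g) = q^2 equals (q^2+q+1)·(Z − 1)·(Z^2 − (q^2−1)Z + 2q^3 − 2q^2 − q + 1). -/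
noncomputable section

open MvPolynomial

namespace Ver

set_option linter.unusedSectionVars false

open Finset Classical

/-- Quadratic form with six coefficients. -/
def qv {F K : Type*} [Field F] [Field K] [Algebra F K] (a b c d e h : K) (v : Fin 3 → F) : K :=
  a * algebraMap F K (v 0) ^ 2 + b * algebraMap F K (v 1) ^ 2 + c * algebraMap F K (v 2) ^ 2
  + d * (algebraMap F K (v 1) * algebraMap F K (v 2))
  + e * (algebraMap F K (v 0) * algebraMap F K (v 2))
  + h * (algebraMap F K (v 0) * algebraMap F K (v 1))

def IsQ {F K : Type*} [Field F] [Field K] [Algebra F K] (φ : (Fin 3 → F) → K) : Prop :=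
  ∃ a b c d e h : K, ∀ v, φ v = qv a b c d e h v

/-- linear independence of three vectors -/
def Ind {F : Type*} [Field F] (a b c : Fin 3 → F) : Prop :=
  ∀ r s t : F, r • a + s • b + t • c = 0 → r = 0 ∧ s = 0 ∧ t = 0

/-- substitution map -/
def gm {F : Type*} [Field F] (a b c : Fin 3 → F) (v : Fin 3 → F) : Fin 3 → F :=
  v 0 • a + v 1 • b + v 2 • c

section
variable {F K : Type*} [Field F] [Field K] [Algebra F K]

theorem IsQ.comp {φ : (Fin 3 → F) → K} (hφ : IsQ φ) (x y z : Fin 3 → F) :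
    IsQ (φ ∘ gm x y z) := by
  obtain ⟨a, b, c, d, e, h, H⟩ := hφ
  let m := algebraMap F K
  let P : (Fin 3 → F) → (Fin 3 → F) → K := fun x y =>
    2 * a * m (x 0) * m (y 0) + 2 * b * m (x 1) * m (y 1) + 2 * c * m (x 2) * m (y 2)
    + d * (m (x 1) * m (y 2) + m (x 2) * m (y 1))
    + e * (m (x 0) * m (y 2) + m (x 2) * m (y 0))
    + h * (m (x 0) * m (y 1) + m (x 1) * m (y 0))
  refine ⟨φ x, φ y, φ z, P y z, P x z, P x y, fun v => ?_⟩
  simp only [Function.comp, H, qv, gm, Pi.add_apply, Pi.smul_apply, smul_eq_mul, map_add, map_mul,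
    P, m]
  ring

theorem IsQ.two {φ : (Fin 3 → F) → K} (hφ : IsQ φ) (x y : Fin 3 → F) :
    ∃ β : K, ∀ s t : F, φ (s • x + t • y) = algebraMap F K s ^ 2 * φ x + algebraMap F K t ^ 2 * φ y
      + algebraMap F K s * algebraMap F K t * β := by
  obtain ⟨a, b, c, d, e, h, H⟩ := hφ
  let m := algebraMap F K
  let P : (Fin 3 → F) → (Fin 3 → F) → K := fun x y =>
    2 * a * m (x 0) * m (y 0) + 2 * b * m (x 1) * m (y 1) + 2 * c * m (x 2) * m (y 2)
    + d * (m (x 1) * m (y 2) + m (x 2) * m (y 1))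
    + e * (m (x 0) * m (y 2) + m (x 2) * m (y 0))
    + h * (m (x 0) * m (y 1) + m (x 1) * m (y 0))
  refine ⟨P x y, fun s t => ?_⟩
  simp only [H, qv, Pi.add_apply, Pi.smul_apply, smul_eq_mul, map_add, map_mul,
    P, m]
  ring

theorem IsQ.smul {φ : (Fin 3 → F) → K} (hφ : IsQ φ) (s : F) (x : Fin 3 → F) :
    φ (s • x) = algebraMap F K s ^ 2 * φ x := by
  obtain ⟨β, h⟩ := hφ.two x 0
  have := h s 0
  simpa using this

theorem Ind.iff (a b c : Fin 3 → F) : Ind a b c ↔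
    a ≠ 0 ∧ (∀ s : F, b ≠ s • a) ∧ (∀ s t : F, c ≠ s • a + t • b) := by
  constructor
  · intro h
    refine ⟨?_, ?_, ?_⟩
    · rintro rfl
      have := h 1 0 0 (by simp)
      simp at this
    · rintro s rfl
      have := h s (-1) 0 (by simp)
      simp at this
    · rintro s t rfl
      have := h s t (-1) (by module)
      simp at this
  · rintro ⟨h0, h1, h2⟩ r s t h
    have ht : t = 0 := by
      by_contra ht
      apply h2 (-(t⁻¹ * r)) (-(t⁻¹ * s))
      have : t⁻¹ • (r • a + s • b + t • c) = 0 := by rw [h, smul_zero]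
      rw [smul_add, smul_add, smul_smul, smul_smul, smul_smul, inv_mul_cancel₀ ht] at this
      rw [← sub_eq_zero, ← this]
      module
    subst ht
    have hs : s = 0 := by
      by_contra hs
      apply h1 (-(s⁻¹ * r))
      have : s⁻¹ • (r • a + s • b + (0:F) • c) = 0 := by rw [h, smul_zero]
      rw [smul_add, smul_add, smul_smul, smul_smul, smul_smul, inv_mul_cancel₀ hs] at this
      rw [← sub_eq_zero, ← this]
      module
    subst hs
    simp [h0] at h
    simp [h]

theorem gm_inj {a b c : Fin 3 → F} (h : Ind a b c) : Function.Injective (gm a b c) := by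
  intro v w hvw
  have := h (v 0 - w 0) (v 1 - w 1) (v 2 - w 2) (by
    have : gm a b c v - gm a b c w = 0 := sub_eq_zero.2 hvw
    rw [← this]; unfold gm; module)
  funext i
  fin_cases i
  · exact sub_eq_zero.1 this.1
  · exact sub_eq_zero.1 this.2.1
  · exact sub_eq_zero.1 this.2.2

variable [Fintype F] [Fintype K]

/-- zero set -/
def NN (φ : (Fin 3 → F) → K) : Finset (Fin 3 → F) := univ.filter (fun v => φ v = 0)

def XX (F K : Type*) [Field F] [Field K] [Algebra F K] [Fintype F] [Fintype K] :
    Finset ((Fin 3 → F) → K) :=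
  univ.filter (fun φ => IsQ φ ∧ #(NN φ) = Fintype.card F ^ 2)

def PA (φ : (Fin 3 → F) → K) : Prop :=
  ∃ a b c, Ind a b c ∧ ∀ s t : F, φ (s • a + t • b) = 0

def TT (F : Type*) [Field F] [Fintype F] : Finset ((Fin 3 → F) × (Fin 3 → F) × (Fin 3 → F)) :=
  univ.filter (fun v => Ind v.1 v.2.1 v.2.2)

/-- line and plane -/
def ln (a : Fin 3 → F) : Finset (Fin 3 → F) := univ.image (fun s : F => s • a)
def pl (a b : Fin 3 → F) : Finset (Fin 3 → F) := univ.image (fun s : F × F => s.1 • a + s.2 • b)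

theorem mem_NN (φ : (Fin 3 → F) → K) (v) : v ∈ NN φ ↔ φ v = 0 := by simp [NN]

theorem mem_ln (a v : Fin 3 → F) : v ∈ ln a ↔ ∃ s : F, v = s • a := by
  simp [ln, eq_comm]
theorem mem_pl (a b v : Fin 3 → F) : v ∈ pl a b ↔ ∃ s t : F, v = s • a + t • b := by
  simp [pl, eq_comm]

theorem Ind.iff' (a b c : Fin 3 → F) : Ind a b c ↔ a ≠ 0 ∧ b ∉ ln a ∧ c ∉ pl a b := by
  rw [Ind.iff, mem_ln, mem_pl]; push Not; rfl

theorem card_ln {a : Fin 3 → F} (h : a ≠ 0) : #(ln a) = Fintype.card F := by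
  rw [ln, card_image_of_injective, card_univ]
  exact smul_left_injective F h

theorem card_pl {a b : Fin 3 → F} (h : a ≠ 0) (hb : b ∉ ln a) :
    #(pl a b) = Fintype.card F ^ 2 := by
  rw [pl, card_image_of_injective, card_univ, Fintype.card_prod, sq]
  rintro ⟨s, t⟩ ⟨s', t'⟩ he
  simp only at he
  have ht : t = t' := by
    by_contra hne
    have h1 : t - t' ≠ 0 := sub_ne_zero.2 hne
    apply hb
    rw [mem_ln]
    refine ⟨(t - t')⁻¹ * (s' - s), ?_⟩
    have : (t - t') • b = (s' - s) • a := by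
      rw [← sub_eq_zero] at he ⊢
      rw [← he]; module
    rw [mul_smul, ← this, smul_smul, inv_mul_cancel₀ h1, one_smul]
  subst ht
  have := smul_left_injective F h (add_right_cancel he)
  rw [this]

theorem card_triple {α : Type*} [Fintype α] (p : α → α → α → Prop)
    [DecidablePred (fun v : α × α × α => p v.1 v.2.1 v.2.2)]
    (S0 : Finset α) (S1 : α → Finset α) (S2 : α → α → Finset α) (n0 n1 n2 : ℕ)
    (hp : ∀ a b c, p a b c ↔ a ∈ S0 ∧ b ∈ S1 a ∧ c ∈ S2 a b)
    (h0 : #S0 = n0) (h1 : ∀ a ∈ S0, #(S1 a) = n1) (h2 : ∀ a ∈ S0, ∀ b ∈ S1 a, #(S2 a b) = n2) :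
    #(univ.filter (fun v : α × α × α => p v.1 v.2.1 v.2.2)) = n0 * (n1 * n2) := by
  have : #(univ.filter (fun v : α × α × α => p v.1 v.2.1 v.2.2)) =
      #(S0.sigma (fun a => (S1 a).sigma (fun b => S2 a b))) := by
    refine card_bij' (fun v _ => ⟨v.1, v.2.1, v.2.2⟩) (fun v _ => (v.1, v.2.1, v.2.2)) ?_ ?_ ?_ ?_
    · rintro ⟨a, b, c⟩ h
      simpa [hp] using h
    · rintro ⟨a, b, c⟩ h
      simpa [hp] using h
    · rintro ⟨a, b, c⟩ h
      rfl
    · rintro ⟨a, b, c⟩ h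
      rfl
  rw [this, card_sigma, sum_congr rfl (g := fun _ => n1 * n2), sum_const, h0, smul_eq_mul]
  intro a ha
  rw [card_sigma, sum_congr rfl (fun b hb => h2 a ha b hb), sum_const, h1 a ha, smul_eq_mul]

theorem card_V : Fintype.card (Fin 3 → F) = Fintype.card F ^ 3 := by simp

theorem card_TT : #(TT F) = (Fintype.card F ^ 3 - 1) * ((Fintype.card F ^ 3 - Fintype.card F) *
    (Fintype.card F ^ 3 - Fintype.card F ^ 2)) := by
  apply card_triple (fun a b c => Ind a b c) ({0}ᶜ) (fun a => (ln a)ᶜ) (fun a b => (pl a b)ᶜ)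
  · intro a b c
    simp [Ind.iff']
  · rw [card_compl, card_V, card_singleton]
  · intro a ha
    rw [card_compl, card_V, card_ln (by simpa using ha)]
  · intro a ha b hb
    rw [card_compl, card_V, card_pl (by simpa using ha) (by simpa using hb)]

/-- structure in case A -/
theorem caseA {φ : (Fin 3 → F) → K} (hX : φ ∈ XX F K) {a b c : Fin 3 → F} (h : Ind a b c)
    (hz : ∀ s t : F, φ (s • a + t • b) = 0) : NN φ = pl a b := by
  symm
  apply eq_of_subset_of_card_le
  · intro v hv
    obtain ⟨s, t, rfl⟩ := (mem_pl _ _ _).1 hv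
    exact (mem_NN _ _).2 (hz s t)
  · simp only [XX, mem_filter] at hX
    rw [Ind.iff'] at h
    rw [card_pl h.1 h.2.1, hX.2.2]

theorem pl_comb {a b x y : Fin 3 → F} (hx : x ∈ pl a b) (hy : y ∈ pl a b) (s t : F) :
    s • x + t • y ∈ pl a b := by
  obtain ⟨s1, t1, rfl⟩ := (mem_pl _ _ _).1 hx
  obtain ⟨s2, t2, rfl⟩ := (mem_pl _ _ _).1 hy
  exact (mem_pl _ _ _).2 ⟨s * s1 + t * s2, s * t1 + t * t2, by module⟩

theorem pl_eq {a b x y : Fin 3 → F} (ha : a ≠ 0) (hb : b ∉ ln a)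
    (hx : x ∈ pl a b) (hy : y ∈ pl a b) (hx0 : x ≠ 0) (hy0 : y ∉ ln x) : pl x y = pl a b := by
  apply eq_of_subset_of_card_le
  · intro v hv
    obtain ⟨s, t, rfl⟩ := (mem_pl _ _ _).1 hv
    exact pl_comb hx hy s t
  · rw [card_pl ha hb, card_pl hx0 hy0]

theorem mem_pl_left (a b : Fin 3 → F) : a ∈ pl a b := (mem_pl _ _ _).2 ⟨1, 0, by simp⟩
theorem mem_pl_right (a b : Fin 3 → F) : b ∈ pl a b := (mem_pl _ _ _).2 ⟨0, 1, by simp⟩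
theorem zero_mem_pl (a b : Fin 3 → F) : 0 ∈ pl a b := (mem_pl _ _ _).2 ⟨0, 0, by simp⟩
theorem ln_sub_pl {a b x : Fin 3 → F} (hx : x ∈ pl a b) : ln x ⊆ pl a b := by
  intro v hv
  obtain ⟨s, rfl⟩ := (mem_ln _ _).1 hv
  simpa using pl_comb hx hx s 0

theorem countA {φ : (Fin 3 → F) → K} (hX : φ ∈ XX F K) (hA : PA φ) :
    #((TT F).filter (fun v => ∀ s t : F, φ (s • v.1 + t • v.2.1) = 0)) =
    (Fintype.card F ^ 2 - 1) * ((Fintype.card F ^ 2 - Fintype.card F) *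
    (Fintype.card F ^ 3 - Fintype.card F ^ 2)) := by
  obtain ⟨a, b, c, h, hz⟩ := hA
  have hN := caseA hX h hz
  rw [Ind.iff'] at h
  obtain ⟨ha, hb, -⟩ := h
  rw [TT, filter_filter]
  apply card_triple (fun x y z => Ind x y z ∧ ∀ s t : F, φ (s • x + t • y) = 0) (pl a b \ {0})
    (fun x => pl a b \ ln x) (fun x y => (pl x y)ᶜ)
  · intro x y z
    rw [Ind.iff']
    simp only [mem_sdiff, mem_singleton, mem_compl]
    constructor
    · rintro ⟨⟨h1, h2, h3⟩, h4⟩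
      refine ⟨⟨?_, h1⟩, ⟨?_, h2⟩, h3⟩
      · rw [← hN, mem_NN]; simpa using h4 1 0
      · rw [← hN, mem_NN]; simpa using h4 0 1
    · rintro ⟨⟨h0, h1⟩, ⟨h2, h3⟩, h4⟩
      refine ⟨⟨h1, h3, h4⟩, fun s t => ?_⟩
      rw [← mem_NN, hN]
      exact pl_comb h0 h2 s t
  · rw [card_sdiff_of_subset (by simpa using zero_mem_pl a b), card_pl ha hb, card_singleton]
  · intro x hx
    simp only [mem_sdiff, mem_singleton] at hx
    rw [card_sdiff_of_subset (ln_sub_pl hx.1), card_pl ha hb, card_ln hx.2]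
  · intro x hx y hy
    simp only [mem_sdiff, mem_singleton] at hx hy
    rw [card_compl, card_V, card_pl hx.2 hy.2]

theorem exists_third {a b : Fin 3 → F} (ha : a ≠ 0) (hb : b ∉ ln a) : ∃ c, Ind a b c := by
  have : ∃ c, c ∉ pl a b := by
    by_contra! hh
    have h1 : pl a b = univ := eq_univ_of_forall hh
    have h2 := card_pl ha hb
    rw [h1, card_univ, card_V] at h2
    have := Nat.pow_right_injective (a := Fintype.card F) Fintype.one_lt_card h2
    omega
  obtain ⟨c, hc⟩ := this
  exact ⟨c, (Ind.iff' _ _ _).2 ⟨ha, hb, hc⟩⟩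

theorem caseB {φ : (Fin 3 → F) → K} (hX : φ ∈ XX F K) (hA : ¬ PA φ) {a b : Fin 3 → F}
    (ha : a ≠ 0) (hb : b ∉ ln a) (hza : φ a = 0) (hzb : φ b = 0) (s t : F)
    (h : φ (s • a + t • b) = 0) : s = 0 ∨ t = 0 := by
  have hQ : IsQ φ := by simp only [XX, mem_filter] at hX; exact hX.2.1
  obtain ⟨β, hβ⟩ := hQ.two a b
  rw [hβ, hza, hzb] at h
  simp at h
  rcases h with h | h
  · exact h
  · exfalso
    apply hA
    obtain ⟨c, hc⟩ := exists_third ha hb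
    refine ⟨a, b, c, hc, fun s t => ?_⟩
    rw [hβ, hza, hzb, h]; simp

theorem countB {φ : (Fin 3 → F) → K} (hX : φ ∈ XX F K) (hA : ¬ PA φ) :
    #((TT F).filter (fun v => φ v.1 = 0 ∧ φ v.2.1 = 0 ∧ φ v.2.2 = 0)) =
    (Fintype.card F ^ 2 - 1) * ((Fintype.card F ^ 2 - Fintype.card F) *
    (Fintype.card F ^ 2 - (2 * Fintype.card F - 1))) := by
  have hQ : IsQ φ ∧ #(NN φ) = Fintype.card F ^ 2 := by
    simp only [XX, mem_filter] at hX; exact hX.2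
  have hln : ∀ x, φ x = 0 → ln x ⊆ NN φ := by
    intro x hx v hv
    obtain ⟨s, rfl⟩ := (mem_ln _ _).1 hv
    rw [mem_NN, hQ.1.smul, hx, mul_zero]
  rw [TT, filter_filter]
  apply card_triple (fun x y z => Ind x y z ∧ φ x = 0 ∧ φ y = 0 ∧ φ z = 0) (NN φ \ {0})
    (fun x => NN φ \ ln x) (fun x y => NN φ \ (ln x ∪ ln y))
  · intro x y z
    rw [Ind.iff']
    simp only [mem_sdiff, mem_singleton, mem_NN, mem_union, not_or]
    constructor
    · rintro ⟨⟨h1, h2, h3⟩, h4, h5, h6⟩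
      exact ⟨⟨h4, h1⟩, ⟨h5, h2⟩, h6, fun h => h3 (ln_sub_pl (mem_pl_left _ _) h),
        fun h => h3 (ln_sub_pl (mem_pl_right _ _) h)⟩
    · rintro ⟨⟨h4, h1⟩, ⟨h5, h2⟩, h6, h7, h8⟩
      refine ⟨⟨h1, h2, fun h => ?_⟩, h4, h5, h6⟩
      obtain ⟨s, t, rfl⟩ := (mem_pl _ _ _).1 h
      rcases caseB hX hA h1 h2 h4 h5 s t h6 with rfl | rfl
      · exact h8 ((mem_ln _ _).2 ⟨t, by simp⟩)
      · exact h7 ((mem_ln _ _).2 ⟨s, by simp⟩)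
  · rw [card_sdiff_of_subset, hQ.2, card_singleton]
    have := hQ.1.smul 0 0
    simpa [mem_NN] using this
  · intro x hx
    simp only [mem_sdiff, mem_singleton, mem_NN] at hx
    rw [card_sdiff_of_subset (hln x hx.1), hQ.2, card_ln hx.2]
  · intro x hx y hy
    simp only [mem_sdiff, mem_singleton, mem_NN] at hx hy
    have hy0 : y ≠ 0 := by
      rintro rfl
      exact hy.2 ((mem_ln _ _).2 ⟨0, by simp⟩)
    rw [card_sdiff_of_subset (union_subset (hln x hx.1) (hln y hy.1)), hQ.2, card_union,
      card_ln hx.2, card_ln hy0]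
    have : ln x ∩ ln y = {0} := by
      ext v
      simp only [mem_inter, mem_ln, mem_singleton]
      constructor
      · rintro ⟨⟨s, rfl⟩, t, ht⟩
        by_cases h : t = 0
        · rw [ht, h, zero_smul]
        · exfalso
          apply hy.2
          rw [mem_ln]
          exact ⟨t⁻¹ * s, by rw [mul_smul, ht, smul_smul, inv_mul_cancel₀ h, one_smul]⟩
      · rintro rfl
        exact ⟨⟨0, by simp⟩, 0, by simp⟩
    rw [this, card_singleton, two_mul]

theorem transport (P : ((Fin 3 → F) → K) → Prop) {a b c : Fin 3 → F} (h : Ind a b c)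
    [DecidablePred P] [DecidablePred (fun φ => P (φ ∘ gm a b c))] :
    #((XX F K).filter (fun φ => P (φ ∘ gm a b c))) = #((XX F K).filter P) := by
  have hbij : Function.Bijective (gm a b c) :=
    Finite.injective_iff_bijective.1 (gm_inj h)
  have hmaps : ∀ φ ∈ XX F K, φ ∘ gm a b c ∈ XX F K := by
    intro φ hφ
    simp only [XX, mem_filter, mem_univ, true_and] at hφ ⊢
    refine ⟨hφ.1.comp _ _ _, ?_⟩
    rw [← hφ.2]
    apply card_bij (fun v _ => gm a b c v)
    · intro v hv; simpa [mem_NN] using hv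
    · intro v _ w _ hh; exact hbij.1 hh
    · intro v hv
      obtain ⟨w, rfl⟩ := hbij.2 v
      exact ⟨w, by simpa [mem_NN] using hv, rfl⟩
  have hinj : Set.InjOn (fun φ : (Fin 3 → F) → K => φ ∘ gm a b c) (XX F K) := by
    intro φ _ ψ _ hh
    exact hbij.2.injective_comp_right hh
  have hsurj := surj_on_of_inj_on_of_card_le (s := XX F K) (t := XX F K)
    (fun φ _ => φ ∘ gm a b c) (fun φ hφ => hmaps φ hφ)
    (fun φ ψ h1 h2 hh => hinj h1 h2 hh) le_rfl
  apply card_bij (fun φ _ => φ ∘ gm a b c)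
  · intro φ hφ
    rw [mem_filter] at hφ ⊢
    exact ⟨hmaps φ hφ.1, hφ.2⟩
  · intro φ h1 ψ h2 hh
    exact hinj (mem_filter.1 h1).1 (mem_filter.1 h2).1 hh
  · intro ψ hψ
    rw [mem_filter] at hψ
    obtain ⟨φ, h1, rfl⟩ := hsurj ψ hψ.1
    exact ⟨φ, mem_filter.2 ⟨h1, hψ.2⟩, rfl⟩

theorem not_PA {φ : (Fin 3 → F) → K} (hX : φ ∈ XX F K) {a b c : Fin 3 → F} (h : Ind a b c)
    (ha : φ a = 0) (hb : φ b = 0) (hc : φ c = 0) : ¬ PA φ := by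
  rintro ⟨x, y, z, h1, h2⟩
  have hN := caseA hX h1 h2
  rw [Ind.iff'] at h h1
  rw [← mem_NN, hN] at ha hb hc
  rw [pl_eq h1.1 h1.2.1 ha hb h.1 h.2.1] at h
  exact h.2.2 hc

/-- the two normal-form families -/
def MA (F K : Type*) [Field F] [Field K] [Algebra F K] [Fintype F] [Fintype K] : ℕ :=
  #((XX F K).filter (fun φ => ∀ s t : F, φ (![s, t, 0]) = 0))
def MB (F K : Type*) [Field F] [Field K] [Algebra F K] [Fintype F] [Fintype K] : ℕ :=
  #((XX F K).filter (fun φ => φ (![1, 0, 0]) = 0 ∧ φ (![0, 1, 0]) = 0 ∧ φ (![0, 0, 1]) = 0))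

theorem doubleA : #((XX F K).filter PA) * ((Fintype.card F ^ 2 - 1) *
    ((Fintype.card F ^ 2 - Fintype.card F) * (Fintype.card F ^ 3 - Fintype.card F ^ 2))) =
    #(TT F) * MA F K := by
  apply card_mul_eq_card_mul (fun φ v => ∀ s t : F, φ (s • v.1 + t • v.2.1) = 0)
  · intro φ hφ
    rw [mem_filter] at hφ
    exact countA hφ.1 hφ.2
  · rintro ⟨a, b, c⟩ hv
    have hv : Ind a b c := by simpa [TT] using hv
    rw [MA, ← transport (fun φ => ∀ s t : F, φ (![s, t, 0]) = 0) hv, bipartiteBelow, filter_filter]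
    congr 1
    apply filter_congr
    intro φ _
    simp only [Function.comp, gm]
    simp
    exact fun h => ⟨a, b, c, hv, h⟩

theorem doubleB : #((XX F K).filter (fun φ => ¬ PA φ)) * ((Fintype.card F ^ 2 - 1) *
    ((Fintype.card F ^ 2 - Fintype.card F) *
    (Fintype.card F ^ 2 - (2 * Fintype.card F - 1)))) =
    #(TT F) * MB F K := by
  apply card_mul_eq_card_mul (fun φ v => φ v.1 = 0 ∧ φ v.2.1 = 0 ∧ φ v.2.2 = 0)
  · intro φ hφ
    rw [mem_filter] at hφ
    exact countB hφ.1 hφ.2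
  · rintro ⟨a, b, c⟩ hv
    have hv : Ind a b c := by simpa [TT] using hv
    rw [MB, ← transport (fun φ => φ (![1, 0, 0]) = 0 ∧ φ (![0, 1, 0]) = 0 ∧ φ (![0, 0, 1]) = 0) hv, bipartiteBelow, filter_filter]
    congr 1
    apply filter_congr
    intro φ hX
    simp only [Function.comp, gm]
    simp
    exact fun h1 h2 h3 => not_PA hX hv h1 h2 h3

/-- lines and planes in `K` viewed as an `F`-space -/
def kl (F : Type*) {K : Type*} [Field F] [Field K] [Algebra F K] [Fintype F] (a : K) : Finset K :=
  univ.image (fun s : F => s • a)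
def kp (F : Type*) {K : Type*} [Field F] [Field K] [Algebra F K] [Fintype F] (a b : K) : Finset K :=
  univ.image (fun s : F × F => s.1 • a + s.2 • b)

theorem mem_kl (a v : K) : v ∈ kl F a ↔ ∃ s : F, v = s • a := by
  simp [kl, eq_comm]
theorem mem_kp (a b v : K) : v ∈ kp F a b ↔ ∃ s t : F, v = s • a + t • b := by
  simp [kp, eq_comm]

theorem card_kl {a : K} (h : a ≠ 0) : #(kl F a) = Fintype.card F := by
  rw [kl, card_image_of_injective, card_univ]
  exact smul_left_injective F h

theorem card_kp {a b : K} (h : a ≠ 0) (hb : b ∉ kl F a) :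
    #(kp F a b) = Fintype.card F ^ 2 := by
  rw [kp, card_image_of_injective, card_univ, Fintype.card_prod, sq]
  rintro ⟨s, t⟩ ⟨s', t'⟩ he
  simp only at he
  have ht : t = t' := by
    by_contra hne
    have h1 : t - t' ≠ 0 := sub_ne_zero.2 hne
    apply hb
    rw [mem_kl]
    refine ⟨(t - t')⁻¹ * (s' - s), ?_⟩
    have : (t - t') • b = (s' - s) • a := by
      rw [← sub_eq_zero] at he ⊢
      rw [← he]; module
    rw [mul_smul, ← this, smul_smul, inv_mul_cancel₀ h1, one_smul]
  subst ht
  have := smul_left_injective F h (add_right_cancel he)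
  rw [this]

theorem kp_zero_left (e : K) : kp F 0 e = kl F e := by
  ext v; simp [mem_kl, mem_kp]

theorem kp_dep (d e : K) (h : e ∈ kl F d) : kp F d e = kl F d := by
  obtain ⟨r, rfl⟩ := (mem_kl _ _).1 h
  ext v
  rw [mem_kl, mem_kp]
  constructor
  · rintro ⟨s, t, rfl⟩
    exact ⟨s + t * r, by module⟩
  · rintro ⟨s, rfl⟩
    exact ⟨s, 0, by module⟩

theorem kl_zero : kl F (0 : K) = {0} := by
  ext v; simp [mem_kl]

theorem sumE (d : K) : (∑ e : K, ((Fintype.card K : ℤ) - #(kp F d e))) =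
    if d = 0 then ((Fintype.card K : ℤ) - 1) + ((Fintype.card K : ℤ) - 1) *
      ((Fintype.card K : ℤ) - Fintype.card F)
    else (Fintype.card F : ℤ) * ((Fintype.card K : ℤ) - Fintype.card F) +
      ((Fintype.card K : ℤ) - Fintype.card F) * ((Fintype.card K : ℤ) - Fintype.card F ^ 2) := by
  split_ifs with hd
  · subst hd
    rw [← add_sum_erase univ _ (mem_univ (0 : K)), kp_zero_left, kl_zero, card_singleton]
    congr 1
    rw [sum_congr rfl (g := fun _ => (Fintype.card K : ℤ) - Fintype.card F), sum_const,
      card_erase_of_mem (mem_univ _), card_univ, nsmul_eq_mul, Nat.cast_sub Fintype.card_pos]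
    · simp
    · intro e he
      rw [kp_zero_left, card_kl (by simpa using he)]
  · rw [← sum_add_sum_compl (kl F d)]
    congr 1
    · rw [sum_congr rfl (g := fun _ => (Fintype.card K : ℤ) - Fintype.card F), sum_const,
        card_kl hd, nsmul_eq_mul]
      intro e he
      rw [kp_dep _ _ he, card_kl hd]
    · rw [sum_congr rfl (g := fun _ => (Fintype.card K : ℤ) - Fintype.card F ^ 2), sum_const,
        card_compl, card_kl hd, nsmul_eq_mul, Nat.cast_sub]
      · rw [← card_kl (F := F) hd]; exact card_le_univ _
      · intro e he
        rw [card_kp hd (by simpa using he)]; push_cast; rfl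

theorem sumDE : (∑ d : K, ∑ e : K, ((Fintype.card K : ℤ) - #(kp F d e))) =
    ((Fintype.card K : ℤ) - 1) * (1 + ((Fintype.card F : ℤ) + 1) *
      ((Fintype.card K : ℤ) - Fintype.card F) +
      ((Fintype.card K : ℤ) - Fintype.card F) * ((Fintype.card K : ℤ) - Fintype.card F ^ 2)) := by
  rw [sum_congr rfl (fun d _ => sumE d), ← add_sum_erase univ _ (mem_univ (0 : K)), if_pos rfl]
  rw [sum_congr rfl (fun d hd => if_neg (by simpa using hd)), sum_const,
      card_erase_of_mem (mem_univ _), card_univ, nsmul_eq_mul, Nat.cast_sub Fintype.card_pos]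
  push_cast
  ring

def SA (F K : Type*) [Field F] [Field K] [Algebra F K] [Fintype F] [Fintype K] :
    Finset (Σ _ : K, Σ _ : K, K) :=
  univ.sigma (fun d => univ.sigma (fun e => (kp F d e)ᶜ))

theorem card_SA : (#(SA F K) : ℤ) = ((Fintype.card K : ℤ) - 1) * (1 + ((Fintype.card F : ℤ) + 1) *
      ((Fintype.card K : ℤ) - Fintype.card F) +
      ((Fintype.card K : ℤ) - Fintype.card F) * ((Fintype.card K : ℤ) - Fintype.card F ^ 2)) := by
  rw [← sumDE, SA, card_sigma, Nat.cast_sum]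
  apply sum_congr rfl
  intro d _
  rw [card_sigma, Nat.cast_sum]
  apply sum_congr rfl
  intro e _
  rw [card_compl, Nat.cast_sub (card_le_univ _)]

theorem isQ_qv (a b c d e h : K) : IsQ (qv a b c d e h : (Fin 3 → F) → K) :=
  ⟨a, b, c, d, e, h, fun _ => rfl⟩

theorem ind_std : Ind (![1, 0, 0] : Fin 3 → F) ![0, 1, 0] ![0, 0, 1] := by
  intro r s t h
  have h0 := congr_fun h 0
  have h1 := congr_fun h 1
  have h2 := congr_fun h 2
  simp at h0 h1 h2
  exact ⟨h0, h1, h2⟩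

theorem NN_SA {c d e : K} : #(NN (qv 0 0 c d e 0 : (Fin 3 → F) → K)) = Fintype.card F ^ 2 ↔
    c ∉ kp F d e := by
  have hind := (Ind.iff' _ _ _).1 (ind_std (F := F))
  have hsub : pl (![1, 0, 0] : Fin 3 → F) ![0, 1, 0] ⊆ NN (qv 0 0 c d e 0) := by
    intro v hv
    obtain ⟨s, t, rfl⟩ := (mem_pl _ _ _).1 hv
    rw [mem_NN]; simp [qv]
  have hcard := card_pl hind.1 hind.2.1
  constructor
  · intro h hc
    have hN := eq_of_subset_of_card_le hsub (by rw [hcard, h])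
    obtain ⟨s, t, hst⟩ := (mem_kp _ _ _).1 hc
    have : (![-t, -s, 1] : Fin 3 → F) ∈ NN (qv 0 0 c d e 0) := by
      rw [mem_NN]; simp [qv, hst, Algebra.smul_def]; ring
    rw [← hN, mem_pl] at this
    obtain ⟨x, y, hxy⟩ := this
    have := congr_fun hxy 2
    simp at this
  · intro hc
    rw [← hcard]
    congr 1
    refine (Subset.antisymm hsub ?_).symm
    intro v hv
    rw [mem_NN] at hv
    by_cases h2 : v 2 = 0
    · rw [mem_pl]
      refine ⟨v 0, v 1, ?_⟩
      funext i
      fin_cases i <;> simp [h2]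
    · exfalso
      apply hc
      rw [mem_kp]
      refine ⟨-(v 1 / v 2), -(v 0 / v 2), ?_⟩
      have h2' : algebraMap F K (v 2) ≠ 0 := by simpa using h2
      simp only [Algebra.smul_def, map_neg, map_div₀]
      field_simp
      simp only [qv] at hv
      have : algebraMap F K (v 2) * (c * algebraMap F K (v 2) + d * algebraMap F K (v 1)
        + e * algebraMap F K (v 0)) = 0 := by rw [← hv]; ring
      have := (mul_eq_zero.1 this).resolve_left h2'
      linear_combination this

theorem MA_eq : MA F K = #(SA F K) := by
  symm
  apply card_bij (fun x _ => qv 0 0 x.2.2 x.1 x.2.1 0)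
  · rintro ⟨d, e, c⟩ h
    have h : c ∉ kp F d e := by simpa [SA] using h
    simp only [XX, mem_filter, mem_univ, true_and]
    refine ⟨⟨isQ_qv _ _ _ _ _ _, NN_SA.2 h⟩, ?_⟩
    intro s t
    simp [qv]
  · rintro ⟨d, e, c⟩ _ ⟨d', e', c'⟩ _ h
    have h1 := congr_fun h ![0, 0, 1]
    have h2 := congr_fun h ![0, 1, 1]
    have h3 := congr_fun h ![1, 0, 1]
    simp [qv] at h1 h2 h3
    subst h1
    simp at h2 h3
    subst h2 h3
    rfl
  · intro φ hφ
    simp only [XX, mem_filter, mem_univ, true_and] at hφ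
    obtain ⟨⟨⟨a, b, c, d, e, h, H⟩, hN⟩, hz⟩ := hφ
    have h1 := hz 1 0
    have h2 := hz 0 1
    have h3 := hz 1 1
    rw [H] at h1 h2 h3
    simp [qv] at h1 h2 h3
    subst h1 h2
    simp at h3
    subst h3
    obtain rfl : φ = qv 0 0 c d e 0 := funext H
    refine ⟨⟨d, e, c⟩, ?_, rfl⟩
    simpa [SA] using NN_SA.1 hN

def RR {F K : Type*} [Field F] [Field K] [Algebra F K] [Fintype F] (d e h : K) : Finset (F × F) :=
  univ.filter (fun p => d * (algebraMap F K p.1 * algebraMap F K p.2) + e * algebraMap F K p.2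
    + h * algebraMap F K p.1 = 0)

theorem card_NN_B {d e h : K} (hd : d ≠ 0) :
    #(NN (qv 0 0 0 d e h : (Fin 3 → F) → K)) + (Fintype.card F - 1) ^ 2 =
    Fintype.card F ^ 2 + (Fintype.card F - 1) * #(RR d e h : Finset (F × F)) := by
  rw [← card_filter_add_card_filter_not (s := NN (qv 0 0 0 d e h : (Fin 3 → F) → K))
    (fun v => v 0 = 0)]
  have h1 : #((NN (qv 0 0 0 d e h : (Fin 3 → F) → K)).filter (fun v => v 0 = 0)) =
      #((univ : Finset (F × F)).filter (fun p => p.1 * p.2 = 0)) := by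
    refine card_bij' (fun v _ => (v 1, v 2)) (fun p _ => ![0, p.1, p.2]) ?_ ?_ ?_ ?_
    · intro v hv
      simp only [mem_filter, mem_NN, qv] at hv
      simpa [hv.2, hd] using hv.1
    · intro p hp
      simpa [mem_NN, qv, hd] using hp
    · intro v hv
      simp only [mem_filter, mem_NN, qv] at hv
      funext i
      fin_cases i <;> simp [hv.2]
    · intro p hp
      simp
  have h2 : #((univ : Finset (F × F)).filter (fun p => p.1 * p.2 = 0)) + (Fintype.card F - 1) ^ 2
      = Fintype.card F ^ 2 := by
    have h3 : #((univ : Finset (F × F)).filter (fun p => ¬ p.1 * p.2 = 0)) =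
        (Fintype.card F - 1) ^ 2 := by
      have : ((univ : Finset (F × F)).filter (fun p => ¬ p.1 * p.2 = 0)) =
          ({0}ᶜ : Finset F) ×ˢ ({0}ᶜ : Finset F) := by
        ext p; simp
      rw [this, card_product, card_compl, card_singleton, sq]
    rw [← h3, card_filter_add_card_filter_not, card_univ, Fintype.card_prod, sq]
  have h4 : #((NN (qv 0 0 0 d e h : (Fin 3 → F) → K)).filter (fun v => ¬ v 0 = 0)) =
      (Fintype.card F - 1) * #(RR d e h : Finset (F × F)) := by
    have : #(({0}ᶜ : Finset F) ×ˢ (RR d e h : Finset (F × F))) =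
        (Fintype.card F - 1) * #(RR d e h : Finset (F × F)) := by
      rw [card_product, card_compl, card_singleton]
    rw [← this]
    refine card_bij' (fun v _ => (v 0, v 1 / v 0, v 2 / v 0))
      (fun p _ => ![p.1, p.1 * p.2.1, p.1 * p.2.2]) ?_ ?_ ?_ ?_
    · intro v hv
      simp only [mem_filter, mem_NN, qv] at hv
      obtain ⟨hv, h0⟩ := hv
      have h0' : algebraMap F K (v 0) ≠ 0 := by simpa using h0
      simp only [mem_product, mem_compl, mem_singleton, h0, not_false_eq_true, true_and, RR,
        mem_filter, mem_univ, map_div₀]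
      field_simp
      linear_combination hv
    · rintro ⟨x, s, t⟩ hp
      simp only [mem_product, mem_compl, mem_singleton, RR, mem_filter, mem_univ, true_and] at hp
      simp only [mem_filter, mem_NN, qv]
      simp
      refine ⟨?_, hp.1⟩
      linear_combination algebraMap F K x ^ 2 * hp.2
    · intro v hv
      simp only [mem_filter, mem_NN, qv] at hv
      have h0 := hv.2
      funext i
      fin_cases i <;> simp <;> field_simp
    · rintro ⟨x, s, t⟩ hp
      simp only [mem_product, mem_compl, mem_singleton] at hp
      have h0 := hp.1
      simp [h0]
  rw [h1, h4]
  omega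

theorem NN_iff_RR {d e h : K} (hd : d ≠ 0) :
    #(NN (qv 0 0 0 d e h : (Fin 3 → F) → K)) = Fintype.card F ^ 2 ↔
    #(RR d e h : Finset (F × F)) = Fintype.card F - 1 := by
  have h1 := card_NN_B (F := F) (d := d) (e := e) (h := h) hd
  have h2 : 0 < Fintype.card F - 1 := by
    have := Fintype.one_lt_card (α := F); omega
  constructor
  · intro hN
    rw [hN] at h1
    have := Nat.add_left_cancel h1
    rw [sq] at this
    exact (Nat.eq_of_mul_eq_mul_left h2 this).symm
  · intro hR
    rw [hR] at h1
    rw [sq] at h1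
    exact Nat.add_right_cancel h1

theorem card_RR {k : K} {β γ : F} (hk : k ≠ 0) (hβ : β ≠ 0) (hγ : γ ≠ 0) :
    #(RR k (k * algebraMap F K β) (k * algebraMap F K γ) : Finset (F × F)) =
    Fintype.card F - 1 := by
  have : #({-β}ᶜ : Finset F) = Fintype.card F - 1 := by rw [card_compl, card_singleton]
  rw [← this]
  have key : ∀ s t : F, (s, t) ∈ (RR k (k * algebraMap F K β) (k * algebraMap F K γ) :
      Finset (F × F)) ↔ s * t + β * t + γ * s = 0 := by
    intro s t
    simp only [RR, mem_filter, mem_univ, true_and]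
    rw [← (algebraMap F K).injective.eq_iff]
    simp only [map_add, map_mul, map_zero]
    constructor
    · intro h
      refine (mul_eq_zero.1 ?_).resolve_left hk
      rw [← h]; ring
    · intro h
      linear_combination k * h
  refine card_bij' (fun p _ => p.1) (fun s _ => (s, -(γ * s) / (s + β))) ?_ ?_ ?_ ?_
  · rintro ⟨s, t⟩ h
    rw [key] at h
    simp only [mem_compl, mem_singleton]
    rintro rfl
    have : γ * β = 0 := by linear_combination -h
    simp [hβ, hγ] at this
  · intro s hs
    simp only [mem_compl, mem_singleton] at hs
    have : s + β ≠ 0 := fun h => hs (eq_neg_of_add_eq_zero_left h)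
    rw [key]
    field_simp
    ring
  · rintro ⟨s, t⟩ h
    rw [key] at h
    have : s + β ≠ 0 := by
      intro h0
      obtain rfl : s = -β := eq_neg_of_add_eq_zero_left h0
      have : γ * β = 0 := by linear_combination -h
      simp [hβ, hγ] at this
    ext
    · rfl
    · simp only
      field_simp
      linear_combination -h
  · intro s hs
    rfl

theorem RR_ratio {d e h : K} (hd : d ≠ 0) (he : e ≠ 0) (hh : h ≠ 0)
    (hR : 3 ≤ #(RR d e h : Finset (F × F))) :
    ∃ β γ : F, β ≠ 0 ∧ γ ≠ 0 ∧ e = d * algebraMap F K β ∧ h = d * algebraMap F K γ := by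
  have h1 : 1 < #((RR d e h : Finset (F × F)).erase (0, 0)) := by
    have := pred_card_le_card_erase (s := (RR d e h : Finset (F × F))) (a := (0, 0))
    omega
  obtain ⟨⟨s, t⟩, h1, ⟨s', t'⟩, h2, hne⟩ := one_lt_card.1 h1
  simp only [RR, mem_erase, mem_filter, mem_univ, true_and, ne_eq] at h1 h2
  have nz : ∀ s t : F, ¬ (s, t) = (0, 0) → d * (algebraMap F K s * algebraMap F K t)
      + e * algebraMap F K t + h * algebraMap F K s = 0 → s ≠ 0 ∧ t ≠ 0 := by
    intro s t hn hz
    constructor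
    · rintro rfl
      simp [he] at hz
      simp [hz] at hn
    · rintro rfl
      simp [hh] at hz
      simp [hz] at hn
  obtain ⟨hs, ht⟩ := nz s t h1.1 h1.2
  obtain ⟨hs', ht'⟩ := nz s' t' h2.1 h2.2
  have E1 : e * algebraMap F K (t * s' - t' * s) = d * algebraMap F K (s * s' * (t' - t)) := by
    simp only [map_sub, map_mul]
    linear_combination algebraMap F K s' * h1.2 - algebraMap F K s * h2.2
  have E2 : h * algebraMap F K (t * s' - t' * s) = d * algebraMap F K (t * t' * (s - s')) := by
    simp only [map_sub, map_mul]
    linear_combination -algebraMap F K t' * h1.2 + algebraMap F K t * h2.2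
  have hΔ : t * s' - t' * s ≠ 0 := by
    intro h0
    rw [h0] at E1 E2
    simp [hd, hs, hs', ht, ht', sub_eq_zero] at E1 E2
    exact hne (by rw [E1, E2])
  have hΔ' : algebraMap F K (t * s' - t' * s) ≠ 0 :=
    (map_ne_zero _).2 hΔ
  have e1 : e = d * algebraMap F K (s * s' * (t' - t) / (t * s' - t' * s)) := by
    rw [map_div₀, ← mul_div_assoc, ← E1, mul_div_cancel_right₀ _ hΔ']
  have e2 : h = d * algebraMap F K (t * t' * (s - s') / (t * s' - t' * s)) := by
    rw [map_div₀, ← mul_div_assoc, ← E2, mul_div_cancel_right₀ _ hΔ']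
  refine ⟨_, _, ?_, ?_, e1, e2⟩
  · intro h0; rw [h0] at e1; simp at e1; exact he e1
  · intro h0; rw [h0] at e2; simp at e2; exact hh e2

theorem MB_eq (hq : 4 ≤ Fintype.card F) :
    MB F K = (Fintype.card K - 1) * ((Fintype.card F - 1) * (Fintype.card F - 1)) := by
  have : #(({0}ᶜ : Finset K) ×ˢ (({0}ᶜ : Finset F) ×ˢ ({0}ᶜ : Finset F))) =
      (Fintype.card K - 1) * ((Fintype.card F - 1) * (Fintype.card F - 1)) := by
    rw [card_product, card_product, card_compl, card_compl, card_singleton, card_singleton]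
  rw [← this]
  symm
  apply card_bij (fun x _ => qv 0 0 0 x.1 (x.1 * algebraMap F K x.2.1) (x.1 * algebraMap F K x.2.2))
  · rintro ⟨k, β, γ⟩ hx
    simp only [mem_product, mem_compl, mem_singleton] at hx
    obtain ⟨hk, hβ, hγ⟩ := hx
    simp only [XX, mem_filter, mem_univ, true_and]
    refine ⟨⟨isQ_qv _ _ _ _ _ _, (NN_iff_RR hk).2 (card_RR hk hβ hγ)⟩, ?_⟩
    simp [qv]
  · rintro ⟨k, β, γ⟩ hx ⟨k', β', γ'⟩ hx' h
    simp only [mem_product, mem_compl, mem_singleton] at hx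
    have h1 := congr_fun h ![0, 1, 1]
    have h2 := congr_fun h ![1, 0, 1]
    have h3 := congr_fun h ![1, 1, 0]
    simp [qv] at h1 h2 h3
    subst h1
    simp [hx.1] at h2 h3
    subst h2 h3
    rfl
  · intro φ hφ
    rw [mem_filter] at hφ
    obtain ⟨hX, z0, z1, z2⟩ := hφ
    have hnA := not_PA hX ind_std z0 z1 z2
    simp only [XX, mem_filter, mem_univ, true_and] at hX
    obtain ⟨⟨a, b, c, d, e, h, H⟩, hN⟩ := hX
    rw [H] at z0 z1 z2
    simp [qv] at z0 z1 z2
    subst z0 z1 z2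
    obtain rfl : φ = qv 0 0 0 d e h := funext H
    have hd : d ≠ 0 := by
      rintro rfl
      refine hnA ⟨![0, 1, 0], ![0, 0, 1], ![1, 0, 0], ?_, ?_⟩
      · intro r s t hh
        have := ind_std (F := F) t r s (by rw [← hh]; module)
        tauto
      · intro s t; simp [qv]
    have he : e ≠ 0 := by
      rintro rfl
      refine hnA ⟨![1, 0, 0], ![0, 0, 1], ![0, 1, 0], ?_, ?_⟩
      · intro r s t hh
        have := ind_std (F := F) r t s (by rw [← hh]; module)
        tauto
      · intro s t; simp [qv]
    have hh : h ≠ 0 := by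
      rintro rfl
      refine hnA ⟨![1, 0, 0], ![0, 1, 0], ![0, 0, 1], ind_std, ?_⟩
      intro s t; simp [qv]
    rw [NN_iff_RR hd] at hN
    obtain ⟨β, γ, hβ, hγ, rfl, rfl⟩ := RR_ratio (F := F) hd he hh (by omega)
    exact ⟨(d, β, γ), by simp [hd, hβ, hγ], rfl⟩

theorem card_XX (hq : 4 ≤ Fintype.card F) : (#(XX F K) : ℤ) =
    ((Fintype.card F : ℤ) ^ 2 + Fintype.card F + 1) * ((Fintype.card K : ℤ) - 1) *
        ((Fintype.card K : ℤ) ^ 2 - ((Fintype.card F : ℤ) ^ 2 - 1) * (Fintype.card K : ℤ) +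
          2 * Fintype.card F ^ 3 - 2 * Fintype.card F ^ 2 - Fintype.card F + 1) := by
  have hA := doubleA (F := F) (K := K)
  have hB := doubleB (F := F) (K := K)
  have hMA := card_SA (F := F) (K := K)
  rw [MA_eq, card_TT] at hA
  rw [MB_eq hq, card_TT] at hB
  rw [← card_filter_add_card_filter_not (s := XX F K) PA]
  have hZ : 1 ≤ Fintype.card K := Fintype.card_pos
  generalize #((XX F K).filter PA) = A at *
  generalize #((XX F K).filter (fun φ => ¬ PA φ)) = B at *
  generalize #(SA F K) = M at *
  generalize Fintype.card F = q at *
  generalize Fintype.card K = Z at *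
  zify at hA hB
  have i1 : 1 ≤ q ^ 2 := by nlinarith
  have i2 : 1 ≤ q ^ 3 := Nat.one_le_pow _ _ (by omega)
  have i3 : q ≤ q ^ 2 := by nlinarith
  have i4 : q ^ 2 ≤ q ^ 3 := Nat.pow_le_pow_right (by omega) (by omega)
  have i5 : q ≤ q ^ 3 := i3.trans i4
  have i6 : 2 * q - 1 ≤ q ^ 2 := by
    have : 2 * q ≤ q ^ 2 := by nlinarith
    omega
  have i7 : 1 ≤ 2 * q := by omega
  have i8 : 1 ≤ q := by omega
  push_cast [Nat.cast_sub i1, Nat.cast_sub i2, Nat.cast_sub i3, Nat.cast_sub i4, Nat.cast_sub i5,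
    Nat.cast_sub i6, Nat.cast_sub i7, Nat.cast_sub i8, Nat.cast_sub hZ] at hA hB
  rw [hMA] at hA
  push_cast
  have hq' : (4 : ℤ) ≤ q := by exact_mod_cast hq
  generalize (q : ℤ) = q at *
  generalize (Z : ℤ) = Z at *
  have n0 : q ≠ 0 := by omega
  have n1 : q - 1 ≠ 0 := by omega
  have n2 : q + 1 ≠ 0 := by omega
  have eA : (A : ℤ) = (q ^ 2 + q + 1) *
      ((Z - 1) * (1 + (q + 1) * (Z - q) + (Z - q) * (Z - q ^ 2))) := by
    have : (q * q * q * (q - 1) * (q - 1) * (q - 1) * (q + 1)) ≠ 0 := by positivity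
    apply mul_left_cancel₀ this
    linear_combination hA
  have eB : (B : ℤ) = (q ^ 2 + q + 1) * (q ^ 2 * (q - 1) * (Z - 1)) := by
    have : (q * (q - 1) * (q - 1) * (q + 1) * (q - 1) * (q - 1)) ≠ 0 := by positivity
    apply mul_left_cancel₀ this
    linear_combination hB
  rw [eA, eB]
  ring

end

theorem isQ_of_homog {F K : Type*} [Field F] [Field K] [Algebra F K] (f : MvPolynomial (Fin 3) K)
    (hf : f.IsHomogeneous 2) :
    IsQ (fun v : Fin 3 → F => MvPolynomial.aeval (fun i => algebraMap F K (v i)) f) := by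
  have hadd : ∀ (s : Finset (Fin 3 →₀ ℕ)) (φ : (Fin 3 →₀ ℕ) → (Fin 3 → F) → K),
      (∀ i ∈ s, IsQ (φ i)) → IsQ (fun v => ∑ i ∈ s, φ i v) := by
    intro s φ
    induction s using Finset.induction_on with
    | empty => intro _; exact ⟨0, 0, 0, 0, 0, 0, fun v => by simp [qv]⟩
    | insert i s hi ih =>
      intro h
      obtain ⟨a, b, c, d, e, h1, H⟩ := h i (mem_insert_self _ _)
      obtain ⟨a', b', c', d', e', h1', H'⟩ := ih (fun j hj => h j (mem_insert_of_mem hj))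
      refine ⟨a + a', b + b', c + c', d + d', e + e', h1 + h1', fun v => ?_⟩
      have H'' := H' v
      simp only at H'' ⊢
      rw [sum_insert hi, H'', H]
      simp only [qv]; ring
  have : (fun v : Fin 3 → F => MvPolynomial.aeval (fun i => algebraMap F K (v i)) f) =
      fun v => ∑ i ∈ f.support, f.coeff i * (algebraMap F K (v 0) ^ (i 0) *
        algebraMap F K (v 1) ^ (i 1) * algebraMap F K (v 2) ^ (i 2)) := by
    funext v
    rw [MvPolynomial.aeval_def, MvPolynomial.eval₂_eq']
    simp [Fin.prod_univ_three]
  rw [this]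
  apply hadd f.support (fun i v => f.coeff i * (algebraMap F K (v 0) ^ (i 0) *
        algebraMap F K (v 1) ^ (i 1) * algebraMap F K (v 2) ^ (i 2)))
  intro i hi
  have hdeg : i 0 + i 1 + i 2 = 2 := by
    have := hf (MvPolynomial.mem_support_iff.1 hi)
    rw [Finsupp.weight_apply, Finsupp.sum_fintype _ _ (by simp)] at this
    simpa [Fin.sum_univ_three] using this
  have hc : (i 0 = 2 ∧ i 1 = 0 ∧ i 2 = 0) ∨ (i 0 = 0 ∧ i 1 = 2 ∧ i 2 = 0) ∨
    (i 0 = 0 ∧ i 1 = 0 ∧ i 2 = 2) ∨ (i 0 = 0 ∧ i 1 = 1 ∧ i 2 = 1) ∨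
    (i 0 = 1 ∧ i 1 = 0 ∧ i 2 = 1) ∨ (i 0 = 1 ∧ i 1 = 1 ∧ i 2 = 0) := by omega
  generalize f.coeff i = x
  rcases hc with ⟨h0, h1, h2⟩ | ⟨h0, h1, h2⟩ | ⟨h0, h1, h2⟩ | ⟨h0, h1, h2⟩ | ⟨h0, h1, h2⟩ |
    ⟨h0, h1, h2⟩ <;> simp only [h0, h1, h2]
  · exact ⟨x, 0, 0, 0, 0, 0, fun v => by simp [qv]⟩
  · exact ⟨0, x, 0, 0, 0, 0, fun v => by simp [qv]⟩
  · exact ⟨0, 0, x, 0, 0, 0, fun v => by simp [qv]⟩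
  · exact ⟨0, 0, 0, x, 0, 0, fun v => by simp [qv]⟩
  · exact ⟨0, 0, 0, 0, x, 0, fun v => by simp [qv]⟩
  · exact ⟨0, 0, 0, 0, 0, x, fun v => by simp [qv]⟩

theorem mem_code {F K : Type*} [Field F] [Field K] [Algebra F K] (rep : Plane F → (Fin 3 → F))
    (g : Plane F → K) :
    g ∈ VeroneseCodeExt K rep ↔ ∃ φ : (Fin 3 → F) → K, IsQ φ ∧ φ ∘ rep = g := by
  rw [VeroneseCodeExt, Submodule.mem_map]
  constructor
  · rintro ⟨f, hf, rfl⟩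
    exact ⟨_, isQ_of_homog f ((MvPolynomial.mem_homogeneousSubmodule _ _).1 hf), rfl⟩
  · rintro ⟨φ, ⟨a, b, c, d, e, h, H⟩, rfl⟩
    have hX : ∀ (i j : Fin 3) (r : K),
        (C r * (X i * X j) : MvPolynomial (Fin 3) K).IsHomogeneous 2 := by
      intro i j r
      have := (isHomogeneous_C (Fin 3) r).mul
        ((isHomogeneous_X K i).mul (isHomogeneous_X K j))
      simpa using this
    refine ⟨C a * (X 0 * X 0) + C b * (X 1 * X 1) + C c * (X 2 * X 2) + C d * (X 1 * X 2)
      + C e * (X 0 * X 2) + C h * (X 0 * X 1), ?_, ?_⟩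
    · rw [MvPolynomial.mem_homogeneousSubmodule]
      exact ((((((hX _ _ _).add (hX _ _ _)).add (hX _ _ _)).add (hX _ _ _)).add
        (hX _ _ _)).add (hX _ _ _))
    · funext p
      simp [H, qv]
      ring

section
variable {F K : Type*} [Field F] [Field K] [Algebra F K] [Fintype F] [Fintype K]

theorem rep_surj (rep : Plane F → (Fin 3 → F))
    (hrep : ∀ p : Plane F, ∃ h : rep p ≠ 0, Projectivization.mk F (rep p) h = p)
    (v : Fin 3 → F) (hv : v ≠ 0) : ∃ u : Fˣ, u • rep (Projectivization.mk F v hv) = v := by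
  obtain ⟨h, h1⟩ := hrep (Projectivization.mk F v hv)
  obtain ⟨u, hu⟩ := (Projectivization.mk_eq_mk_iff F _ _ h hv).1 h1
  exact ⟨u⁻¹, by rw [← hu, inv_smul_smul]⟩

theorem wt_eq (rep : Plane F → (Fin 3 → F))
    (hrep : ∀ p : Plane F, ∃ h : rep p ≠ 0, Projectivization.mk F (rep p) h = p)
    (φ : (Fin 3 → F) → K) (hφ : IsQ φ) :
    #(NN φ) + wt (φ ∘ rep) * (Fintype.card F - 1) = Fintype.card F ^ 3 := by
  have h1 : Nat.card ({p | (φ ∘ rep) p ≠ 0} × Fˣ) = Nat.card {v : Fin 3 → F | φ v ≠ 0} := by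
    have hnz : ∀ (u : Fˣ) x, φ (u • x) ≠ 0 ↔ φ x ≠ 0 := by
      intro u x
      have := hφ.smul (u : F) x
      rw [← Units.smul_def] at this
      rw [this]; simp
    refine Nat.card_congr (Equiv.ofBijective
      (fun x => ⟨x.2 • rep x.1.1, (hnz _ _).2 x.1.2⟩) ⟨?_, ?_⟩)
    · rintro ⟨⟨p, hp⟩, u⟩ ⟨⟨p', hp'⟩, u'⟩ he
      simp only [Subtype.mk.injEq] at he
      obtain ⟨h, h1⟩ := hrep p
      obtain ⟨h', h1'⟩ := hrep p'
      have hpp : p = p' := by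
        rw [← h1, ← h1', Projectivization.mk_eq_mk_iff]
        exact ⟨u⁻¹ * u', by rw [mul_smul, ← he, inv_smul_smul]⟩
      subst hpp
      have : u = u' := by
        apply Units.ext
        exact smul_left_injective F h he
      subst this
      rfl
    · rintro ⟨v, hv⟩
      have hv0 : v ≠ 0 := by
        rintro rfl
        have := hφ.smul 0 0
        simp at this
        exact hv this
      obtain ⟨u, hu⟩ := rep_surj rep hrep v hv0
      refine ⟨⟨⟨Projectivization.mk F v hv0, ?_⟩, u⟩, ?_⟩
      · change φ (rep _) ≠ 0
        rw [← hnz u, hu]; exact hv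
      · simp only [hu]
  rw [Nat.card_prod, Nat.card_units, Nat.card_eq_fintype_card (α := F)] at h1
  have h2 : Nat.card {v : Fin 3 → F | φ v ≠ 0} = #(univ.filter (fun v : Fin 3 → F => ¬ φ v = 0)) := by
    rw [Nat.card_eq_fintype_card, Fintype.card_subtype]; rfl
  have h3 : Nat.card {p | (φ ∘ rep) p ≠ 0} = wt (φ ∘ rep) := rfl
  rw [h3, h2] at h1
  rw [h1, NN, card_filter_add_card_filter_not, card_univ, card_V]

theorem card_code (rep : Plane F → (Fin 3 → F))
    (hrep : ∀ p : Plane F, ∃ h : rep p ≠ 0, Projectivization.mk F (rep p) h = p) :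
    Nat.card {g : Plane F → K | g ∈ VeroneseCodeExt K rep ∧ wt g = Fintype.card F ^ 2} =
    #(XX F K) := by
  have hwt : ∀ φ : (Fin 3 → F) → K, IsQ φ →
      (wt (φ ∘ rep) = Fintype.card F ^ 2 ↔ #(NN φ) = Fintype.card F ^ 2) := by
    intro φ hφ
    have h := wt_eq rep hrep φ hφ
    have hq : 1 < Fintype.card F := Fintype.one_lt_card
    obtain ⟨m, hm⟩ : ∃ m, Fintype.card F = m + 2 := ⟨_, (Nat.sub_add_cancel hq).symm⟩
    rw [hm] at h ⊢
    have e : m + 2 - 1 = m + 1 := by omega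
    rw [e] at h
    constructor
    · intro hw
      rw [hw] at h
      nlinarith
    · intro hw
      rw [hw] at h
      have : wt (φ ∘ rep) * (m + 1) = (m + 2) ^ 2 * (m + 1) := by nlinarith
      exact Nat.eq_of_mul_eq_mul_right (by omega) this
  have himg : {g : Plane F → K | g ∈ VeroneseCodeExt K rep ∧ wt g = Fintype.card F ^ 2} =
      (fun φ => φ ∘ rep) '' (XX F K : Set ((Fin 3 → F) → K)) := by
    ext g
    simp only [Set.mem_ofPred_eq, mem_code, Set.mem_image, XX, coe_filter, mem_univ, true_and]
    constructor
    · rintro ⟨⟨φ, hφ, rfl⟩, hw⟩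
      exact ⟨φ, ⟨hφ, (hwt φ hφ).1 hw⟩, rfl⟩
    · rintro ⟨φ, ⟨hφ, hN⟩, rfl⟩
      exact ⟨⟨φ, hφ, rfl⟩, (hwt φ hφ).2 hN⟩
  rw [himg, Nat.card_image_of_injOn]
  · simp
  · intro φ h1 ψ h2 he
    simp only [XX, coe_filter, mem_univ, true_and, Set.mem_ofPred_eq] at h1 h2
    funext v
    by_cases hv : v = 0
    · subst hv
      have e1 := h1.1.smul 0 0
      have e2 := h2.1.smul 0 0
      simp at e1 e2
      rw [e1, e2]
    · obtain ⟨u, hu⟩ := rep_surj rep hrep v hv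
      rw [← hu, Units.smul_def, h1.1.smul, h2.1.smul]
      congr 1
      exact congr_fun he _

end

end Ver

theorem veronese_ext_count_weight_qsq
    {F : Type*} [Field F] [Fintype F] (q : ℕ) (hq : Fintype.card F = q) (hq4 : 4 ≤ q)
    (rep : Plane F → (Fin 3 → F))
    (hrep : ∀ p : Plane F, ∃ h : rep p ≠ 0, Projectivization.mk F (rep p) h = p)
    (K : Type*) [Field K] [Fintype K] [Algebra F K] :
    (Nat.card {g : Plane F → K | g ∈ VeroneseCodeExt K rep ∧ wt g = q ^ 2} : ℤ) =
      ((q : ℤ) ^ 2 + q + 1) * ((Fintype.card K : ℤ) - 1) *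
        ((Fintype.card K : ℤ) ^ 2 - ((q : ℤ) ^ 2 - 1) * (Fintype.card K : ℤ) +
          2 * q ^ 3 - 2 * q ^ 2 - q + 1) := by
  subst hq
  rw [Ver.card_code rep hrep]
  exact Ver.card_XX hq4
end
end

section
/- Let q ≥ 4 be a prime power and let K be a finite field extension of F, with Z = |K|. Then the number of codewords g of the extended Veronese code C_q(K) with wt(g) = q^2 + q − 3 equals (q^2+q+1)·(q+1)·q^3·(q−1)^2·(Z − q)·(Z − 1)/24. -/
noncomputable section

open MvPolynomial

/-- `h` is a `K`-valued quadratic form on `F^3`. -/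
def IsQ {F K : Type*} [Field F] [Field K] [Algebra F K] (h : (Fin 3 → F) → K) : Prop :=
  ∃ a b c d e f : K, ∀ x : Fin 3 → F, h x =
    a * algebraMap F K (x 0) ^ 2 + b * algebraMap F K (x 1) ^ 2 + c * algebraMap F K (x 2) ^ 2
    + d * (algebraMap F K (x 0) * algebraMap F K (x 1))
    + e * (algebraMap F K (x 0) * algebraMap F K (x 2))
    + f * (algebraMap F K (x 1) * algebraMap F K (x 2))

section basics
variable {F K : Type*} [Field F] [Field K] [Algebra F K]

lemma isQ_aeval (f : MvPolynomial (Fin 3) K) (hf : f ∈ homogeneousSubmodule (Fin 3) K 2) :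
    IsQ (F := F) (fun x => MvPolynomial.aeval (fun i => algebraMap F K (x i)) f) := by
  rw [← homogeneousSubmodule_one_pow, homogeneousSubmodule_one_eq_span_X, pow_two,
    Submodule.span_mul_span] at hf
  induction hf using Submodule.span_induction with
  | mem y hy =>
    obtain ⟨_, ⟨i, rfl⟩, _, ⟨j, rfl⟩, rfl⟩ := hy
    fin_cases i <;> fin_cases j
    · exact ⟨1, 0, 0, 0, 0, 0, fun x => by simp; ring⟩
    · exact ⟨0, 0, 0, 1, 0, 0, fun x => by simp⟩
    · exact ⟨0, 0, 0, 0, 1, 0, fun x => by simp⟩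
    · exact ⟨0, 0, 0, 1, 0, 0, fun x => by simp; ring⟩
    · exact ⟨0, 1, 0, 0, 0, 0, fun x => by simp; ring⟩
    · exact ⟨0, 0, 0, 0, 0, 1, fun x => by simp⟩
    · exact ⟨0, 0, 0, 0, 1, 0, fun x => by simp; ring⟩
    · exact ⟨0, 0, 0, 0, 0, 1, fun x => by simp; ring⟩
    · exact ⟨0, 0, 1, 0, 0, 0, fun x => by simp; ring⟩
  | zero => exact ⟨0, 0, 0, 0, 0, 0, fun x => by simp⟩
  | add u v _ _ hu hv =>
    obtain ⟨a, b, c, d, e, f, h⟩ := hu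
    obtain ⟨a', b', c', d', e', f', h'⟩ := hv
    refine ⟨a + a', b + b', c + c', d + d', e + e', f + f', fun x => ?_⟩
    have h1 := h x
    have h2 := h' x
    simp only at h1 h2
    simp only [map_add, h1, h2]
    ring
  | smul r u _ hu =>
    obtain ⟨a, b, c, d, e, f, h⟩ := hu
    refine ⟨r * a, r * b, r * c, r * d, r * e, r * f, fun x => ?_⟩
    have h1 := h x
    simp only at h1
    simp only [map_smul, h1, smul_eq_mul]
    ring

lemma IsQ.exists_poly {h : (Fin 3 → F) → K} (hh : IsQ h) :
    ∃ f ∈ homogeneousSubmodule (Fin 3) K 2, ∀ x,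
      MvPolynomial.aeval (fun i => algebraMap F K (x i)) f = h x := by
  obtain ⟨a, b, c, d, e, f, h'⟩ := hh
  have hX : ∀ i j : Fin 3, (X i * X j : MvPolynomial (Fin 3) K) ∈
      homogeneousSubmodule (Fin 3) K 2 := fun i j =>
    (isHomogeneous_X K i).mul (isHomogeneous_X K j)
  refine ⟨a • (X 0 * X 0) + b • (X 1 * X 1) + c • (X 2 * X 2) + d • (X 0 * X 1)
    + e • (X 0 * X 2) + f • (X 1 * X 2), ?_, fun x => ?_⟩
  · refine add_mem (add_mem (add_mem (add_mem (add_mem ?_ ?_) ?_) ?_) ?_) ?_ <;>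
      exact Submodule.smul_mem _ _ (hX _ _)
  · rw [h']
    simp only [map_add, map_smul, map_mul, aeval_X, smul_eq_mul]
    ring

lemma mem_code_iff (rep : Plane F → (Fin 3 → F)) (g : Plane F → K) :
    g ∈ VeroneseCodeExt K rep ↔ ∃ h : (Fin 3 → F) → K, IsQ h ∧ ∀ p, g p = h (rep p) := by
  unfold VeroneseCodeExt
  rw [Submodule.mem_map]
  constructor
  · rintro ⟨f, hf, rfl⟩
    exact ⟨_, isQ_aeval f hf, fun p => rfl⟩
  · rintro ⟨h, hh, hg⟩
    obtain ⟨f, hf, hf'⟩ := hh.exists_poly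
    refine ⟨f, hf, ?_⟩
    ext p
    rw [hg, ← hf']
    rfl

lemma IsQ.smul {h : (Fin 3 → F) → K} (hh : IsQ h) (s : F) (x : Fin 3 → F) :
    h (s • x) = algebraMap F K s ^ 2 * h x := by
  obtain ⟨a, b, c, d, e, f, h'⟩ := hh
  simp only [h', Pi.smul_apply, smul_eq_mul, map_mul]
  ring

lemma IsQ.smul_eq_zero_iff {h : (Fin 3 → F) → K} (hh : IsQ h) {s : F} (hs : s ≠ 0)
    (x : Fin 3 → F) : h (s • x) = 0 ↔ h x = 0 := by
  rw [hh.smul]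
  simp [hs]

lemma IsQ.zero {h : (Fin 3 → F) → K} (hh : IsQ h) : h 0 = 0 := by
  obtain ⟨a, b, c, d, e, f, h'⟩ := hh
  simp [h']

lemma IsQ.line {h : (Fin 3 → F) → K} (hh : IsQ h) (s t : F) (x y : Fin 3 → F) :
    h (s • x + t • y) = algebraMap F K s ^ 2 * h x + algebraMap F K t ^ 2 * h y +
      algebraMap F K s * algebraMap F K t * (h (x + y) - h x - h y) := by
  obtain ⟨a, b, c, d, e, f, h'⟩ := hh
  simp only [h', Pi.smul_apply, Pi.add_apply, smul_eq_mul, map_mul, map_add]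
  ring

lemma IsQ.comp {h : (Fin 3 → F) → K} (hh : IsQ h) (L : (Fin 3 → F) →ₗ[F] (Fin 3 → F)) :
    IsQ (fun x => h (L x)) := by
  set m : Fin 3 → Fin 3 → F := fun i => L (Pi.single i 1) with hm
  have hL : ∀ x, L x = x 0 • m 0 + x 1 • m 1 + x 2 • m 2 := by
    intro x
    have : x = x 0 • (Pi.single 0 1 : Fin 3 → F) + x 1 • (Pi.single 1 1 : Fin 3 → F)
        + x 2 • (Pi.single 2 1 : Fin 3 → F) := by
      ext i; fin_cases i <;> simp
    conv_lhs => rw [this]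
    simp only [map_add, map_smul, hm]
  refine ⟨h (m 0), h (m 1), h (m 2), h (m 0 + m 1) - h (m 0) - h (m 1),
    h (m 0 + m 2) - h (m 0) - h (m 2), h (m 1 + m 2) - h (m 1) - h (m 2), fun x => ?_⟩
  simp only [hL]
  obtain ⟨a, b, c, d, e, f, h'⟩ := hh
  simp only [h', Pi.smul_apply, Pi.add_apply, smul_eq_mul, map_mul, map_add]
  ring

/-- The good configurations: a quadratic form and representatives of its zeros, ordered. -/
def Good (h : (Fin 3 → F) → K) (v : Fin 4 → (Fin 3 → F)) : Prop :=
  IsQ h ∧ (∀ i, v i ≠ 0) ∧ (∀ i j, i ≠ j → ∀ s : F, v i ≠ s • v j) ∧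
    (∀ x, x ≠ 0 → (h x = 0 ↔ ∃ i, ∃ s : F, x = s • v i))

/-- No three zeros of a good configuration are collinear. -/
lemma Good.no_three [Fintype F] (hq : 4 ≤ Fintype.card F) {h : (Fin 3 → F) → K}
    {v : Fin 4 → (Fin 3 → F)} (hg : Good h v) {i j k : Fin 4} (hij : i ≠ j) (hik : i ≠ k)
    (hjk : j ≠ k) (s t : F) : v k ≠ s • v i + t • v j := by
  obtain ⟨hQ, h0, hd, hz⟩ := hg
  intro hk
  have hv : ∀ l, h (v l) = 0 := fun l => (hz _ (h0 l)).2 ⟨l, 1, by simp⟩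
  have hs : s ≠ 0 := by
    rintro rfl
    exact hd k j hjk.symm t (by simpa using hk)
  have ht : t ≠ 0 := by
    rintro rfl
    exact hd k i hik.symm s (by simpa using hk)
  have hB : h (v i + v j) - h (v i) - h (v j) = 0 := by
    have := hQ.line s t (v i) (v j)
    rw [← hk, hv, hv, hv] at this
    simpa [hs, ht, hv] using this
  have hall : ∀ r : F, ∃ l : {l : Fin 4 // l ≠ j}, ∃ c : F, v i + r • v j = c • v l := by
    intro r
    have hne : v i + r • v j ≠ 0 := by
      intro h1
      exact hd i j hij (-r) (by rw [neg_smul]; exact eq_neg_of_add_eq_zero_left h1)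
    have hzr : h (v i + r • v j) = 0 := by
      have := hQ.line 1 r (v i) (v j)
      rw [hB, hv, hv] at this
      simpa using this
    obtain ⟨l, c, hc⟩ := (hz _ hne).1 hzr
    refine ⟨⟨l, ?_⟩, c, hc⟩
    rintro rfl
    apply hd i l hij (c - r)
    rw [sub_smul, ← hc]; simp
  choose l c hc using hall
  have hinj : Function.Injective l := by
    intro r r' hrr
    by_contra hne
    have h1 := hc r
    have h2 := hc r'
    rw [← hrr] at h2
    set w := v (l r)
    have h3 : (r - r') • v j = (c r - c r') • w := by
      rw [sub_smul, sub_smul, ← h1, ← h2]; abel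
    have hrr' : r - r' ≠ 0 := sub_ne_zero.2 hne
    apply hd j (l r) (l r).2.symm ((r - r')⁻¹ * (c r - c r'))
    rw [mul_smul]
    change v j = (r - r')⁻¹ • (c r - c r') • w
    rw [← h3, smul_smul, inv_mul_cancel₀ hrr', one_smul]
  have := Fintype.card_le_of_injective l hinj
  simp at this
  omega

/-- The quadrics through the standard frame `e₀, e₁, e₂, c`. -/
def phi (c : Fin 3 → F) (w : Fin 2 → K) (y : Fin 3 → F) : K :=
  (y 1 * (c 2 * y 0 - c 0 * y 2)) • w 0 + (y 2 * (c 1 * y 0 - c 0 * y 1)) • w 1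

lemma isQ_phi (c : Fin 3 → F) (w : Fin 2 → K) : IsQ (phi c w) := by
  refine ⟨0, 0, 0, algebraMap F K (c 2) * w 0, algebraMap F K (c 1) * w 1,
    - algebraMap F K (c 0) * (w 0 + w 1), fun x => ?_⟩
  simp only [phi, Algebra.smul_def, map_mul, map_sub]
  ring

lemma phi_eq_zero_iff (c : Fin 3 → F) (hc : ∀ i, c i ≠ 0) (w : Fin 2 → K)
    (hw : LinearIndependent F w) (y : Fin 3 → F) :
    phi c w y = 0 ↔ ∃ i : Fin 4, ∃ s : F, y = s • (![Pi.single 0 1, Pi.single 1 1, Pi.single 2 1, c] : Fin 4 → Fin 3 → F) i := by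
  constructor
  · intro h
    have hw' : LinearIndependent F ![w 0, w 1] := by
      convert hw using 1
      ext i; fin_cases i <;> rfl
    obtain ⟨h1, h2⟩ := LinearIndependent.pair_iff.1 hw' _ _ h
    have c0 := hc 0
    have c1 := hc 1
    have c2 := hc 2
    by_cases y1 : y 1 = 0
    · by_cases y2 : y 2 = 0
      · refine ⟨0, y 0, ?_⟩
        ext i; fin_cases i <;> simp [y1, y2]
      · have y0 : y 0 = 0 := by simpa [y1, y2, c1] using h2
        refine ⟨2, y 2, ?_⟩
        ext i; fin_cases i <;> simp [y1, y0]
    · by_cases y2 : y 2 = 0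
      · have y0 : y 0 = 0 := by simpa [y1, y2, c2] using h1
        refine ⟨1, y 1, ?_⟩
        ext i; fin_cases i <;> simp [y2, y0]
      · have e1 : c 2 * y 0 - c 0 * y 2 = 0 := by simpa [y1] using h1
        have e2 : c 1 * y 0 - c 0 * y 1 = 0 := by simpa [y2] using h2
        refine ⟨3, y 0 / c 0, ?_⟩
        ext i; fin_cases i
        · simp [c0]
        · simp; field_simp; linear_combination -e2
        · simp; field_simp; linear_combination -e1
  · rintro ⟨i, s, rfl⟩
    fin_cases i <;> simp [phi]
    simp only [Algebra.smul_def, map_mul, map_sub]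
    ring

/-- A dependent pair produces a fifth zero. -/
lemma phi_extra [Fintype F] (hq : 4 ≤ Fintype.card F) (c : Fin 3 → F) (hc : ∀ i, c i ≠ 0)
    (w : Fin 2 → K) (hw : ¬ LinearIndependent F w) :
    ∃ y, phi c w y = 0 ∧ ¬ ∃ i : Fin 4, ∃ s : F, y = s • (![Pi.single 0 1, Pi.single 1 1, Pi.single 2 1, c] : Fin 4 → Fin 3 → F) i := by
  have hw' : ¬ LinearIndependent F ![w 0, w 1] := by
    convert hw using 2
    ext i; fin_cases i <;> rfl
  rw [LinearIndependent.pair_iff] at hw'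
  push Not at hw'
  obtain ⟨α, β, hab, hne⟩ := hw'
  classical
  obtain ⟨s, hs⟩ : ∃ s : F, s ∉ ({0, 1, β / α} : Finset F) := by
    by_contra hcon
    push Not at hcon
    have h1 : (Finset.univ : Finset F) ⊆ {0, 1, β / α} := fun s _ => hcon s
    have h2 := Finset.card_le_card h1
    have h3 := Finset.card_le_three (a := (0 : F)) (b := 1) (c := β / α)
    rw [Finset.card_univ] at h2
    omega
  simp only [Finset.mem_insert, Finset.mem_singleton, not_or] at hs
  obtain ⟨s0, s1, s2⟩ := hs
  have hD : β - α * s ≠ 0 := by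
    intro h
    by_cases hα : α = 0
    · subst hα
      exact hne rfl (by simpa using h)
    · exact s2 (by field_simp; linear_combination -h)
  set z := (β - α) * s / (β - α * s) with hz
  have hzD : z * (β - α * s) = (β - α) * s := by rw [hz]; field_simp
  refine ⟨![c 0 * z, c 1, c 2 * s], ?_, ?_⟩
  · -- both coefficients are proportional to (α, β)
    have key : β * (z - s) = α * (s * (z - 1)) := by linear_combination hzD
    have : phi c w ![c 0 * z, c 1, c 2 * s] =
        (c 0 * c 1 * c 2) • ((z - s) • w 0 + (s * (z - 1)) • w 1) := by
      simp only [phi, Algebra.smul_def]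
      simp
      ring
    rw [this]
    suffices h : (z - s) • w 0 + (s * (z - 1)) • w 1 = 0 by rw [h, smul_zero]
    by_cases hα : α = 0
    · subst hα
      have hβ : β ≠ 0 := hne rfl
      have h1 : z - s = 0 := by
        rw [zero_mul] at key
        exact (mul_eq_zero.1 key).resolve_left hβ
      have h2 : w 1 = 0 := by simpa [hβ] using hab
      simp [h1, h2]
    · have : α • ((z - s) • w 0 + (s * (z - 1)) • w 1) = (z - s) • (α • w 0 + β • w 1) := by
        rw [smul_add, smul_add, smul_smul, smul_smul, smul_smul, smul_smul, mul_comm α (z - s),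
          ← key, mul_comm β]
      rw [hab, smul_zero] at this
      exact (smul_eq_zero.1 this).resolve_left hα
  · rintro ⟨i, t, ht⟩
    have c0 := hc 0
    have c1 := hc 1
    have c2 := hc 2
    have e1 := congrFun ht 1
    have e2 := congrFun ht 2
    fin_cases i
    · simp [c1] at e1
    · simp [c2, s0] at e2
    · simp [c1] at e1
    · simp [c1] at e1
      simp at e2
      subst e1
      apply s1
      apply mul_left_cancel₀ c2
      rw [e2]; ring
end basics

section bij
variable {F K : Type*} [Field F] [Field K] [Algebra F K]

/-- The standard frame with fourth point `c`. -/
def frame (c : Fin 3 → F) : Fin 4 → Fin 3 → F :=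
  ![Pi.single 0 1, Pi.single 1 1, Pi.single 2 1, c]

lemma frame_ne_zero (c : Fin 3 → F) (hc : ∀ i, c i ≠ 0) (i : Fin 4) : frame c i ≠ 0 := by
  fin_cases i
  · simp [frame]
  · simp [frame]
  · simp [frame]
  · intro h
    exact hc 0 (by simpa [frame] using congrFun h 0)

lemma frame_distinct (c : Fin 3 → F) (hc : ∀ i, c i ≠ 0) (i j : Fin 4) (hij : i ≠ j) (s : F) :
    frame c i ≠ s • frame c j := by
  have c0 := hc 0
  have c1 := hc 1
  have c2 := hc 2
  intro h
  have h0 := congrFun h 0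
  have h1 := congrFun h 1
  have h2 := congrFun h 2
  fin_cases i <;> fin_cases j <;> simp [frame, c0, c1, c2] at h0 h1 h2 hij
  all_goals simp_all

lemma good_phi (E : (Fin 3 → F) ≃ₗ[F] (Fin 3 → F)) (c : Fin 3 → F) (hc : ∀ i, c i ≠ 0)
    (w : Fin 2 → K) (hw : LinearIndependent F w) :
    Good (fun x => phi c w (E.symm x)) (fun i => E (frame c i)) := by
  refine ⟨(isQ_phi c w).comp E.symm.toLinearMap, fun i => ?_, fun i j hij s h => ?_, fun x hx => ?_⟩
  · simpa using frame_ne_zero c hc i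
  · rw [← map_smul] at h
    exact frame_distinct c hc i j hij s (E.injective h)
  · rw [phi_eq_zero_iff c hc w hw]
    refine exists_congr fun i => exists_congr fun s => ?_
    rw [← map_smul, LinearEquiv.symm_apply_eq]
    rfl

lemma equiv_of_linInd (s : Fin 3 → Fin 3 → F) (hs : LinearIndependent F s) :
    ∃ E : (Fin 3 → F) ≃ₗ[F] (Fin 3 → F), ∀ y, E y = y 0 • s 0 + y 1 • s 1 + y 2 • s 2 := by
  let b := basisOfLinearIndependentOfCardEqFinrank hs (by simp)
  refine ⟨b.equivFun.symm, fun y => ?_⟩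
  rw [Module.Basis.equivFun_symm_apply, Fin.sum_univ_three]
  simp [b]

lemma Good.exists_phi [Fintype F] (hq : 4 ≤ Fintype.card F) {h : (Fin 3 → F) → K}
    {v : Fin 4 → (Fin 3 → F)} (hg : Good h v) :
    ∃ (E : (Fin 3 → F) ≃ₗ[F] (Fin 3 → F)) (c : Fin 3 → F) (_ : ∀ i, c i ≠ 0) (w : Fin 2 → K)
      (_ : LinearIndependent F w), h = (fun x => phi c w (E.symm x)) ∧
        v = (fun i => E (frame c i)) := by
  have hno := fun (i j k : Fin 4) (hij : i ≠ j) (hik : i ≠ k) (hjk : j ≠ k) s t =>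
    hg.no_three hq hij hik hjk s t
  obtain ⟨hQ, h0, hd, hz⟩ := hg
  have hli : LinearIndependent F ![v 0, v 1, v 2] := by
    rw [Fintype.linearIndependent_iff]
    intro a ha
    rw [Fin.sum_univ_three] at ha
    simp at ha
    have a2 : a 2 = 0 := by
      by_contra hne
      apply hno 0 1 2 (by decide) (by decide) (by decide) (-(a 2)⁻¹ * a 0) (-(a 2)⁻¹ * a 1)
      have : v 2 = (a 2)⁻¹ • a 2 • v 2 := by rw [smul_smul, inv_mul_cancel₀ hne, one_smul]
      rw [this, ← neg_eq_of_add_eq_zero_right ha]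
      module
    have a1 : a 1 = 0 := by
      by_contra hne
      apply hd 1 0 (by decide) (-(a 1)⁻¹ * a 0)
      have : v 1 = (a 1)⁻¹ • a 1 • v 1 := by rw [smul_smul, inv_mul_cancel₀ hne, one_smul]
      rw [a2, zero_smul, add_zero] at ha
      rw [this, ← neg_eq_of_add_eq_zero_right ha]
      module
    have a0 : a 0 = 0 := by
      simpa [a1, a2, h0 0] using ha
    intro i
    fin_cases i <;> assumption
  obtain ⟨E, hE⟩ := equiv_of_linInd _ hli
  simp at hE
  set c := E.symm (v 3) with hcdef
  have hc3 : E c = v 3 := by simp [hcdef]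
  have hEc := hE c
  rw [hc3] at hEc
  have hc : ∀ i, c i ≠ 0 := by
    intro i hi
    fin_cases i
    · apply hno 1 2 3 (by decide) (by decide) (by decide) (c 1) (c 2)
      simp at hi
      simpa [hi] using hEc
    · apply hno 0 2 3 (by decide) (by decide) (by decide) (c 0) (c 2)
      simp at hi
      simpa [hi] using hEc
    · apply hno 0 1 3 (by decide) (by decide) (by decide) (c 0) (c 1)
      simp at hi
      simpa [hi] using hEc
  have hv : ∀ i, v i = E (frame c i) := by
    intro i
    fin_cases i
    · simp [frame, hE]
    · simp [frame, hE]
    · simp [frame, hE]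
    · simp [frame, hc3]
  have hvz : ∀ i, h (E (frame c i)) = 0 := fun i => by
    rw [← hv]
    exact (hz _ (h0 i)).2 ⟨i, 1, by simp⟩
  have hQ' := hQ.comp E.toLinearMap
  obtain ⟨a, b, d, e, f, g, hh⟩ := hQ'
  simp only [LinearEquiv.coe_coe] at hh
  have z0 := hvz 0
  have z1 := hvz 1
  have z2 := hvz 2
  have z3 := hvz 3
  rw [hh] at z0 z1 z2 z3
  simp [frame] at z0 z1 z2 z3
  subst z0 z1 z2
  have hm : ∀ i, algebraMap F K (c i) ≠ 0 := fun i => by simpa using hc i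
  have m0 := hm 0
  have m1 := hm 1
  have m2 := hm 2
  set w : Fin 2 → K := ![e / algebraMap F K (c 2), f / algebraMap F K (c 1)] with hw
  have hphi : ∀ y, h (E y) = phi c w y := by
    intro y
    rw [hh]
    have hg' : g = -algebraMap F K (c 0) * (w 0 + w 1) := by
      simp [hw]
      field_simp
      linear_combination z3
    simp only [phi, Algebra.smul_def, map_mul, map_sub]
    rw [hg']
    simp [hw]
    field_simp
    ring
  have hwi : LinearIndependent F w := by
    by_contra hcon
    obtain ⟨y, hy, hy'⟩ := phi_extra hq c hc w hcon
    apply hy'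
    have hy0 : y ≠ 0 := by
      rintro rfl
      exact hy' ⟨0, 0, by simp⟩
    have hEy : E y ≠ 0 := by simpa using hy0
    obtain ⟨i, s, hs⟩ := (hz _ hEy).1 (by rw [hphi, hy])
    refine ⟨i, s, ?_⟩
    rw [hv, ← map_smul] at hs
    exact E.injective hs
  refine ⟨E, c, hc, w, hwi, ?_, funext hv⟩
  ext x
  rw [← hphi]
  simp

lemma card_good_left [Fintype F] [Fintype K] (hq : 4 ≤ Fintype.card F) :
    Nat.card {hv : ((Fin 3 → F) → K) × (Fin 4 → Fin 3 → F) // Good hv.1 hv.2} =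
    Nat.card ((Fin 3 → F) ≃ₗ[F] (Fin 3 → F)) * (Nat.card (Fin 3 → Fˣ) *
      Nat.card {w : Fin 2 → K // LinearIndependent F w}) := by
  rw [← Nat.card_prod, ← Nat.card_prod]
  symm
  refine Nat.card_congr (Equiv.ofBijective (fun a => ⟨(fun x => phi (fun i => (a.2.1 i : F)) a.2.2.1 (a.1.symm x),
    fun i => a.1 (frame (fun i => (a.2.1 i : F)) i)), good_phi _ _ (fun i => (a.2.1 i).ne_zero) _ a.2.2.2⟩)
    ⟨?_, ?_⟩)
  · rintro ⟨E, c, w, hw⟩ ⟨E', c', w', hw'⟩ heq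
    simp only [Subtype.mk.injEq, Prod.mk.injEq] at heq
    obtain ⟨h1, h2⟩ := heq
    have hEE : E = E' := by
      apply LinearEquiv.toLinearMap_injective
      apply LinearMap.pi_ext'
      intro i
      ext1
      fin_cases i
      · exact congrFun h2 0
      · exact congrFun h2 1
      · exact congrFun h2 2
    subst hEE
    have hcc : c = c' := by
      have := E.injective (congrFun h2 3)
      ext i
      exact congrFun this i
    subst hcc
    have hww : w = w' := by
      have k1 := congrFun h1 (E ![1, 1, 0])
      have k2 := congrFun h1 (E ![1, 0, 1])
      simp [phi] at k1 k2
      ext i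
      fin_cases i
      · exact k1
      · exact k2
    subst hww
    rfl
  · rintro ⟨⟨h, v⟩, hg⟩
    obtain ⟨E, c, hc, w, hw, e1, e2⟩ := Good.exists_phi hq hg
    refine ⟨⟨E, fun i => Units.mk0 (c i) (hc i), w, hw⟩, ?_⟩
    simp only [Subtype.mk.injEq, Prod.mk.injEq, Units.val_mk0]
    exact ⟨e1.symm, e2.symm⟩

lemma rep_eq {rep : Plane F → (Fin 3 → F)}
    (hrep : ∀ p : Plane F, ∃ h : rep p ≠ 0, Projectivization.mk F (rep p) h = p)
    {p p' : Plane F} {s : F} (h : rep p = s • rep p') : p = p' := by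
  obtain ⟨h1, h2⟩ := hrep p
  obtain ⟨h3, h4⟩ := hrep p'
  rw [← h2, ← h4, Projectivization.mk_eq_mk_iff']
  exact ⟨s, h.symm⟩

lemma exists_rep {rep : Plane F → (Fin 3 → F)}
    (hrep : ∀ p : Plane F, ∃ h : rep p ≠ 0, Projectivization.mk F (rep p) h = p)
    {x : Fin 3 → F} (hx : x ≠ 0) : ∃ p, ∃ s : Fˣ, x = s • rep p := by
  obtain ⟨h1, h2⟩ := hrep (Projectivization.mk F x hx)
  rw [Projectivization.mk_eq_mk_iff] at h2
  obtain ⟨s, hs⟩ := h2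
  exact ⟨_, s⁻¹, by rw [← hs]; simp⟩

lemma card_good_right [Fintype F] [Fintype K] (rep : Plane F → (Fin 3 → F))
    (hrep : ∀ p : Plane F, ∃ h : rep p ≠ 0, Projectivization.mk F (rep p) h = p) :
    Nat.card {hv : ((Fin 3 → F) → K) × (Fin 4 → Fin 3 → F) // Good hv.1 hv.2} =
    Nat.card {h : (Fin 3 → F) → K // IsQ h ∧ Nat.card {p // h (rep p) = 0} = 4} *
      (24 * Nat.card (Fin 4 → Fˣ)) := by
  classical
  have key : ∀ h : {h : (Fin 3 → F) → K // IsQ h ∧ Nat.card {p // h (rep p) = 0} = 4},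
      Nat.card ((Fin 4 ≃ {p // h.1 (rep p) = 0}) × (Fin 4 → Fˣ)) = 24 * Nat.card (Fin 4 → Fˣ) := by
    rintro ⟨h, hQ, h4⟩
    rw [Nat.card_prod]
    congr 1
    let e : {p // h (rep p) = 0} ≃ Fin 4 := Finite.equivFinOfCardEq h4
    rw [Nat.card_congr (Equiv.equivCongr (Equiv.refl (Fin 4)) e), Nat.card_eq_fintype_card, Fintype.card_perm]
    rfl
  have : Nat.card {h : (Fin 3 → F) → K // IsQ h ∧ Nat.card {p // h (rep p) = 0} = 4} *
      (24 * Nat.card (Fin 4 → Fˣ)) = Nat.card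
      (Σ h : {h : (Fin 3 → F) → K // IsQ h ∧ Nat.card {p // h (rep p) = 0} = 4},
        ((Fin 4 ≃ {p // h.1 (rep p) = 0}) × (Fin 4 → Fˣ))) := by
    have := Fintype.ofFinite {h : (Fin 3 → F) → K // IsQ h ∧ Nat.card {p // h (rep p) = 0} = 4}
    rw [Nat.card_sigma]
    simp only [key]
    simp
  rw [this]
  symm
  have hgood : ∀ a : (Σ h : {h : (Fin 3 → F) → K // IsQ h ∧ Nat.card {p // h (rep p) = 0} = 4},
        ((Fin 4 ≃ {p // h.1 (rep p) = 0}) × (Fin 4 → Fˣ))),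
        Good a.1.1 (fun i => (a.2.2 i : F) • rep (a.2.1 i)) := by
    rintro ⟨⟨h, hQ, h4⟩, t, s⟩
    refine ⟨hQ, fun i => ?_, fun i j hij r hr => ?_, fun x hx => ⟨fun h0 => ?_, ?_⟩⟩
    · exact smul_ne_zero (s i).ne_zero (hrep _).1
    · apply hij
      apply t.injective
      apply Subtype.ext
      apply rep_eq hrep (s := (s i : F)⁻¹ * (r * s j))
      simp only at hr
      rw [mul_smul, mul_smul, ← hr, smul_smul, inv_mul_cancel₀ (s i).ne_zero, one_smul]
    · obtain ⟨p, r, rfl⟩ := exists_rep hrep hx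
      have hp : h (rep p) = 0 := (hQ.smul_eq_zero_iff r.ne_zero _).1 h0
      refine ⟨t.symm ⟨p, hp⟩, r * (s (t.symm ⟨p, hp⟩) : F)⁻¹, ?_⟩
      simp [smul_smul, Units.smul_def]
    · rintro ⟨i, r, rfl⟩
      simp only
      have hti : h (rep (t i)) = 0 := (t i).2
      rw [smul_smul, hQ.smul, hti, mul_zero]
  refine Nat.card_congr (Equiv.ofBijective (fun a => ⟨(a.1.1, fun i => (a.2.2 i : F) • rep (a.2.1 i)),
    hgood a⟩) ⟨?_, ?_⟩)
  · rintro ⟨⟨h, hh⟩, t, s⟩ ⟨⟨h', hh'⟩, t', s'⟩ heq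
    simp only [Subtype.mk.injEq, Prod.mk.injEq] at heq
    obtain ⟨h1, h2⟩ := heq
    subst h1
    have htt : t = t' := by
      ext i
      apply rep_eq hrep (s := (s i : F)⁻¹ * s' i)
      rw [mul_smul, ← congrFun h2 i, smul_smul, inv_mul_cancel₀ (s i).ne_zero, one_smul]
    subst htt
    have hss : s = s' := by
      ext i
      exact smul_left_injective F (hrep (t i)).1 (congrFun h2 i)
    subst hss
    rfl
  · rintro ⟨⟨h, v⟩, hQ, h0, hd, hz⟩
    simp only at hQ h0 hd hz
    have hex := fun i => exists_rep hrep (h0 i)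
    choose p s hps using hex
    have hp : ∀ i, h (rep (p i)) = 0 := by
      intro i
      have : h (v i) = 0 := (hz _ (h0 i)).2 ⟨i, 1, by simp⟩
      rw [hps i] at this
      exact (hQ.smul_eq_zero_iff (s i).ne_zero _).1 this
    let t : Fin 4 ≃ {p // h (rep p) = 0} := Equiv.ofBijective (fun i => ⟨p i, hp i⟩) ⟨by
      intro i j hij
      by_contra hne
      simp only [Subtype.mk.injEq] at hij
      apply hd i j hne ((s i : F) * (s j : F)⁻¹)
      rw [hps i, hps j, hij]
      simp [smul_smul, Units.smul_def], by
      rintro ⟨r, hr⟩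
      obtain ⟨i, c, hc⟩ := (hz _ (hrep r).1).1 hr
      refine ⟨i, Subtype.ext ?_⟩
      rw [hps i] at hc
      symm
      apply rep_eq hrep (s := c * s i)
      rw [hc, mul_smul]; rfl⟩
    have h4 : Nat.card {p // h (rep p) = 0} = 4 := by
      rw [← Nat.card_congr t]; simp
    refine ⟨⟨⟨h, hQ, h4⟩, t, s⟩, ?_⟩
    apply Subtype.ext
    refine Prod.ext rfl ?_
    ext1 i
    exact (hps i).symm

lemma card_words [Fintype F] [Fintype K] (rep : Plane F → (Fin 3 → F))
    (hrep : ∀ p : Plane F, ∃ h : rep p ≠ 0, Projectivization.mk F (rep p) h = p) (n : ℕ)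
    (hn : Nat.card (Plane F) = n + 4) :
    Nat.card {g : Plane F → K | g ∈ VeroneseCodeExt K rep ∧ wt g = n} =
      Nat.card {h : (Fin 3 → F) → K // IsQ h ∧ Nat.card {p // h (rep p) = 0} = 4} := by
  classical
  symm
  have hwt : ∀ g : Plane F → K, wt g = n ↔ Nat.card {p // g p = 0} = 4 := by
    intro g
    have h1 : Nat.card {p // g p = 0} + Nat.card {p // ¬ g p = 0} = n + 4 := by
      rw [← hn, ← Nat.card_sum]
      exact Nat.card_congr (Equiv.sumCompl _)
    have h2 : wt g = Nat.card {p // ¬ g p = 0} := rfl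
    omega
  refine Nat.card_congr (Equiv.ofBijective (fun h => ⟨fun p => h.1 (rep p), ?_, ?_⟩) ⟨?_, ?_⟩)
  · exact (mem_code_iff rep _).2 ⟨h.1, h.2.1, fun p => rfl⟩
  · exact (hwt _).2 h.2.2
  · rintro ⟨h, hQ, h4⟩ ⟨h', hQ', h4'⟩ heq
    simp only [Subtype.mk.injEq] at heq
    apply Subtype.ext
    ext x
    simp only
    by_cases hx : x = 0
    · rw [hx, hQ.zero, hQ'.zero]
    · obtain ⟨p, r, rfl⟩ := exists_rep hrep hx
      have : h (rep p) = h' (rep p) := congrFun heq p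
      rw [Units.smul_def, hQ.smul, hQ'.smul, this]
  · rintro ⟨g, hg, hw⟩
    obtain ⟨h, hQ, hh⟩ := (mem_code_iff rep _).1 hg
    have hg' : g = fun p => h (rep p) := funext hh
    subst hg'
    exact ⟨⟨h, hQ, (hwt _).1 hw⟩, rfl⟩

end bij

theorem veronese_ext_count_weight_qsq_add_q_sub_three
    {F : Type*} [Field F] [Fintype F] (q : ℕ) (hq : Fintype.card F = q) (hq4 : 4 ≤ q)
    (rep : Plane F → (Fin 3 → F))
    (hrep : ∀ p : Plane F, ∃ h : rep p ≠ 0, Projectivization.mk F (rep p) h = p)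
    (K : Type*) [Field K] [Fintype K] [Algebra F K] :
    (Nat.card {g : Plane F → K | g ∈ VeroneseCodeExt K rep ∧ wt g = q ^ 2 + q - 3} : ℚ) =
      ((q : ℚ) ^ 2 + q + 1) * ((q : ℚ) + 1) * q ^ 3 * ((q : ℚ) - 1) ^ 2 *
        ((Fintype.card K : ℚ) - q) * ((Fintype.card K : ℚ) - 1) / 24 := by
  classical
  have hP : Nat.card (Plane F) = (q ^ 2 + q - 3) + 4 := by
    rw [Projectivization.card_of_finrank F (Fin 3 → F) (n := 3) (by simp)]
    simp [Finset.sum_range_succ, hq]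
    omega
  rw [card_words rep hrep _ hP]
  have hL := card_good_left (F := F) (K := K) (by omega)
  rw [card_good_right rep hrep] at hL
  set N := Nat.card {h : (Fin 3 → F) → K // IsQ h ∧ Nat.card {p // h (rep p) = 0} = 4}
  have hu : ∀ m, Nat.card (Fin m → Fˣ) = (q - 1) ^ m := by
    intro m
    rw [Nat.card_fun]
    simp [Fintype.card_units, hq]
  have hGL : Nat.card ((Fin 3 → F) ≃ₗ[F] (Fin 3 → F)) =
      (q ^ 3 - 1) * (q ^ 3 - q) * (q ^ 3 - q ^ 2) := by
    rw [← Nat.card_congr (LinearMap.GeneralLinearGroup.generalLinearEquiv F (Fin 3 → F)).toEquiv,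
      ← Nat.card_congr (Matrix.GeneralLinearGroup.toLin (n := Fin 3) (R := F)).toEquiv,
      Matrix.card_GL_field]
    simp [Fin.prod_univ_three, hq]
  have hZ : Fintype.card K = q ^ Module.finrank F K := by
    rw [← hq]; exact Module.card_eq_pow_finrank
  have hZq : q ≤ Fintype.card K := by
    rw [← hq]
    exact Fintype.card_le_of_injective _ (algebraMap F K).injective
  have hLI : Nat.card {w : Fin 2 → K // LinearIndependent F w} =
      (Fintype.card K - 1) * (Fintype.card K - q) := by
    by_cases hk : 2 ≤ Module.finrank F K
    · rw [card_linearIndependent hk, Fin.prod_univ_two, hZ, hq]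
      simp
    · have h1 : Module.finrank F K = 1 := by
        have : 0 < Module.finrank F K := Module.finrank_pos
        omega
      rw [h1, pow_one] at hZ
      rw [hZ, Nat.sub_self, mul_zero]
      have : IsEmpty {w : Fin 2 → K // LinearIndependent F w} := ⟨fun w => by
        have := w.2.fintype_card_le_finrank
        rw [h1] at this
        simp at this⟩
      simp
  rw [hu, hu, hGL, hLI] at hL
  have hL' := congrArg (Nat.cast (R := ℚ)) hL
  have q1 : 1 ≤ q := by omega
  have q2 : 1 ≤ q ^ 3 := Nat.one_le_pow _ _ q1
  have q3 : q ≤ q ^ 3 := Nat.le_self_pow (by norm_num) q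
  have q4 : q ^ 2 ≤ q ^ 3 := Nat.pow_le_pow_right q1 (by norm_num)
  push_cast [Nat.cast_sub q1, Nat.cast_sub q2, Nat.cast_sub q3, Nat.cast_sub q4,
    Nat.cast_sub hZq, Nat.cast_sub (q1.trans hZq)] at hL'
  have hne : ((q : ℚ) - 1) ^ 4 ≠ 0 := by
    have : (4 : ℚ) ≤ q := by exact_mod_cast hq4
    apply pow_ne_zero
    linarith
  rw [eq_div_iff (by norm_num)]
  apply mul_right_cancel₀ hne
  linear_combination hL'
end
end
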